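/- Let 0 < α < 1 and 1 < p < ∞. There exists a constant c > 0 such that for every function f analytic in the unit disk and continuous up to the boundary with boundary values in Λ_α, and for all contractions T and R on a separable Hilbert space with T − R ∈ S_p, the operator f(T) − f(R) belongs to S_{p/α} and ‖f(T) − f(R)‖_{S_{p/α}} ≤ c · ‖f‖_{Λ_α} · ‖T − R‖_{S_p}^α. -/

import Mathlib

open scoped BigOperators
noncomputable section

/-- The `j`-th singular value of a bounded operator `T` on a Hilbert space:
`s_j(T) = inf {‖T - R‖ : rank R ≤ j}`. -/
def sVal {H : Type} [NormedAddCommGroup H] [InnerProductSpace ℂ H] [CompleteSpace H]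
    (T : H →L[ℂ] H) (j : ℕ) : ℝ :=
  sInf {c : ℝ | ∃ R : H →L[ℂ] H, LinearMap.rank (R : H →ₗ[ℂ] H) ≤ (j : Cardinal) ∧ c = ‖T - R‖}

/-- Membership in the Schatten–von Neumann class `S_p`. -/
def MemSchatten {H : Type} [NormedAddCommGroup H] [InnerProductSpace ℂ H] [CompleteSpace H]
    (p : ℝ) (T : H →L[ℂ] H) : Prop :=
  Summable fun j : ℕ => sVal T j ^ p

/-- The Schatten–von Neumann norm `‖T‖_{S_p} = (∑_{j ≥ 0} s_j(T)^p)^{1/p}`. -/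
def schNorm {H : Type} [NormedAddCommGroup H] [InnerProductSpace ℂ H] [CompleteSpace H]
    (p : ℝ) (T : H →L[ℂ] H) : ℝ :=
  (∑' j : ℕ, sVal T j ^ p) ^ (1 / p)

/-- `f` satisfies the Hölder condition of order `α` on the unit circle with constant `C`. -/
def HoelderCircleWith (C α : ℝ) (f : ℂ → ℂ) : Prop :=
  ∀ ζ τ : ℂ, ‖ζ‖ = 1 → ‖τ‖ = 1 → ‖f ζ - f τ‖ ≤ C * ‖ζ - τ‖ ^ α

/-- The Hölder norm on the circle, `‖f‖_{Λ_α} = sup_{ζ ≠ τ} |f(ζ) - f(τ)|/|ζ - τ|^α`, realized as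
the least admissible Hölder constant. -/
def hoelderCircleNorm (α : ℝ) (f : ℂ → ℂ) : ℝ :=
  sInf {C : ℝ | 0 ≤ C ∧ HoelderCircleWith C α f}

/-- Membership in the Hölder class `Λ_α` on the unit circle. -/
def MemHoelderCircle (α : ℝ) (f : ℂ → ℂ) : Prop :=
  ∃ C : ℝ, 0 ≤ C ∧ HoelderCircleWith C α f

open Filter in
/-- `X` is the value `f(T)` of the Sz.-Nagy–Foiaş functional calculus of the contraction `T` at the
disk-algebra function `f`: the continuous extension of the polynomial functional calculus, i.e.
whenever polynomials `q k` converge to `f` uniformly on the closed unit disk, `q k (T) → X`. -/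
def IsSzNagyCalc {H : Type} [NormedAddCommGroup H] [InnerProductSpace ℂ H] [CompleteSpace H]
    (f : ℂ → ℂ) (T X : H →L[ℂ] H) : Prop :=
  ∀ q : ℕ → Polynomial ℂ,
    TendstoUniformlyOn (fun k z => (q k).eval z) f atTop (Metric.closedBall (0 : ℂ) 1) →
    Tendsto (fun k => Polynomial.aeval T (q k)) atTop (nhds X)

open Filter Topology InnerProductSpace

theorem Orthonormal.fin_snoc {H : Type} [NormedAddCommGroup H] [InnerProductSpace ℂ H]
    {k : ℕ} {e : Fin k → H} (he : Orthonormal ℂ e) {v : H}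
    (hv : ‖v‖ = 1) (hev : ∀ i, inner ℂ v (e i) = 0) :
    Orthonormal ℂ (Fin.snoc e v : Fin (k + 1) → H) := by
  rw [orthonormal_iff_ite] at he ⊢
  intro i j
  induction i using Fin.lastCases with
  | last =>
    induction j using Fin.lastCases with
    | last => simp [hv]
    | cast j => simpa [Fin.snoc_castSucc, (Fin.castSucc_lt_last j).ne'] using hev j
  | cast i =>
    induction j using Fin.lastCases with
    | last =>
      have : inner ℂ (e i) v = 0 := inner_eq_zero_symm.1 (hev i)
      simpa [Fin.snoc_castSucc, (Fin.castSucc_lt_last i).ne] using this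
    | cast j => simpa [Fin.snoc_castSucc] using he i j

instance hasOrthogonalProjection_span_range {H : Type} [NormedAddCommGroup H]
    [InnerProductSpace ℂ H] {k : ℕ} (e : Fin k → H) :
    (Submodule.span ℂ (Set.range e)).HasOrthogonalProjection :=
  haveI : FiniteDimensional ℂ (Submodule.span ℂ (Set.range e)) :=
    FiniteDimensional.span_of_finite ℂ (Set.finite_range e)
  inferInstance

theorem rank_starProjection_span_le {H : Type} [NormedAddCommGroup H]
    [InnerProductSpace ℂ H] {k : ℕ} (e : Fin k → H) :
    LinearMap.rank ((Submodule.span ℂ (Set.range e)).starProjection : H →ₗ[ℂ] H) ≤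
      (k : Cardinal) := by
  have h : LinearMap.range ((Submodule.span ℂ (Set.range e)).starProjection : H →ₗ[ℂ] H) ≤
      Submodule.span ℂ (Set.range e) := by
    rintro _ ⟨x, rfl⟩
    exact Submodule.starProjection_apply_mem _ x
  refine (Submodule.rank_mono h).trans ((rank_span_le _).trans ?_)
  simpa using Cardinal.mk_range_le (f := e)

section SingularValues

variable {H : Type} [NormedAddCommGroup H] [InnerProductSpace ℂ H] [CompleteSpace H]

theorem sVal_le_norm_sub (T : H →L[ℂ] H) {j : ℕ} {R : H →L[ℂ] H}
    (hR : LinearMap.rank (R : H →ₗ[ℂ] H) ≤ (j : Cardinal)) : sVal T j ≤ ‖T - R‖ := by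
  refine csInf_le ⟨0, ?_⟩ ⟨R, hR, rfl⟩
  rintro c ⟨S, -, rfl⟩
  exact norm_nonneg _

theorem exists_rank_le_norm_sub_lt (T : H →L[ℂ] H) (j : ℕ) {ε : ℝ} (hε : 0 < ε) :
    ∃ R : H →L[ℂ] H, LinearMap.rank (R : H →ₗ[ℂ] H) ≤ (j : Cardinal) ∧
      ‖T - R‖ < sVal T j + ε := by
  have hne : {c : ℝ | ∃ R : H →L[ℂ] H, LinearMap.rank (R : H →ₗ[ℂ] H) ≤ (j : Cardinal) ∧
      c = ‖T - R‖}.Nonempty := ⟨_, 0, by simp, rfl⟩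
  obtain ⟨c, ⟨R, hR, rfl⟩, hc⟩ := exists_lt_of_csInf_lt hne (lt_add_of_pos_right (sVal T j) hε)
  exact ⟨R, hR, hc⟩

theorem sVal_nonneg (T : H →L[ℂ] H) (j : ℕ) : 0 ≤ sVal T j := by
  refine Real.sInf_nonneg ?_
  rintro c ⟨S, -, rfl⟩
  exact norm_nonneg _

theorem sVal_antitone (T : H →L[ℂ] H) : Antitone (sVal T) := by
  intro i j hij
  refine le_of_forall_pos_lt_add fun ε hε => ?_
  obtain ⟨R, hR, hlt⟩ := exists_rank_le_norm_sub_lt T i hε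
  exact (sVal_le_norm_sub T (hR.trans (by exact_mod_cast hij))).trans_lt hlt

theorem norm_le_sVal_zero (T : H →L[ℂ] H) : ‖T‖ ≤ sVal T 0 := by
  refine le_of_forall_pos_lt_add fun ε hε => ?_
  obtain ⟨R, hR, hlt⟩ := exists_rank_le_norm_sub_lt T 0 hε
  have h0 : (R : H →ₗ[ℂ] H) = 0 := by
    have h1 : LinearMap.rank (R : H →ₗ[ℂ] H) = 0 := by simpa using hR
    exact LinearMap.range_eq_bot.1 (Submodule.rank_eq_zero.1 h1)
  have : R = 0 := by
    ext x
    exact LinearMap.congr_fun h0 x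
  simpa [this] using hlt

/-- If the singular values `s_{2 * j}(N)`, `j < k`, exceed `c ≥ 0`, there are orthonormal systems of
length `k` along which all the matrix entries of `N` exceed `c`. -/
theorem exists_orthonormal_lt_inner (N : H →L[ℂ] H) {c : ℝ} (hc : 0 ≤ c) (k : ℕ)
    (h : ∀ j < k, c < sVal N (2 * j)) :
    ∃ e f : Fin k → H, Orthonormal ℂ e ∧ Orthonormal ℂ f ∧
      ∀ j, c < ‖inner ℂ (f j) (N (e j))‖ := by
  induction k with
  | zero =>
    exact ⟨Fin.elim0, Fin.elim0, ⟨fun i => i.elim0, fun i => i.elim0⟩,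
      ⟨fun i => i.elim0, fun i => i.elim0⟩, fun i => i.elim0⟩
  | succ k ih =>
    obtain ⟨e, f, he, hf, hN⟩ := ih fun j hj => h j (hj.trans k.lt_succ_self)
    set P := (Submodule.span ℂ (Set.range e)).starProjection with hP
    set Q := (Submodule.span ℂ (Set.range f)).starProjection with hQ
    set B : H →L[ℂ] H := Q ∘L N + (N - Q ∘L N) ∘L P with hB
    have hrank : LinearMap.rank (B : H →ₗ[ℂ] H) ≤ ((2 * k : ℕ) : Cardinal) := by
      have h1 : LinearMap.rank ((Q : H →ₗ[ℂ] H) ∘ₗ (N : H →ₗ[ℂ] H)) ≤ (k : Cardinal) :=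
        (LinearMap.rank_comp_le_left _ _).trans (rank_starProjection_span_le f)
      have h2 : LinearMap.rank (((N - Q ∘L N : H →L[ℂ] H) : H →ₗ[ℂ] H) ∘ₗ (P : H →ₗ[ℂ] H)) ≤
          (k : Cardinal) :=
        (LinearMap.rank_comp_le_right _ _).trans (rank_starProjection_span_le e)
      have h3 := (LinearMap.rank_add_le ((Q : H →ₗ[ℂ] H) ∘ₗ (N : H →ₗ[ℂ] H))
        (((N - Q ∘L N : H →L[ℂ] H) : H →ₗ[ℂ] H) ∘ₗ (P : H →ₗ[ℂ] H))).trans (add_le_add h1 h2)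
      rw [two_mul, Nat.cast_add]
      exact h3
    have hlt : c < ‖N - B‖ := (h k k.lt_succ_self).trans_le (sVal_le_norm_sub N hrank)
    obtain ⟨x, hx⟩ : ∃ x, c * ‖x‖ < ‖(N - B) x‖ := by
      by_contra! hcon
      exact absurd (ContinuousLinearMap.opNorm_le_bound _ hc hcon) hlt.not_ge
    set v := x - P x with hv
    set w := N v - Q (N v) with hw
    have hxw : (N - B) x = w := by
      simp only [hB, hw, hv, _root_.sub_apply, _root_.add_apply,
        ContinuousLinearMap.comp_apply, map_sub]
      abel
    rw [hxw] at hx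
    have hvx : ‖v‖ ≤ ‖x‖ := by
      have := (Submodule.span ℂ (Set.range e))ᗮ.starProjection_norm_le
      have h2 := ContinuousLinearMap.le_of_opNorm_le _ this x
      rwa [Submodule.starProjection_orthogonal_val, one_mul] at h2
    have hw0 : 0 < ‖w‖ := (mul_nonneg hc (norm_nonneg x)).trans_lt hx
    have hv0 : 0 < ‖v‖ := by
      rw [norm_pos_iff]
      rintro h0
      simp [hw, h0] at hw0
    have hvw : c * ‖v‖ < ‖w‖ := (mul_le_mul_of_nonneg_left hvx hc).trans_lt hx
    have hve : ∀ i, inner ℂ v (e i) = 0 := fun i =>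
      Submodule.starProjection_inner_eq_zero _ _ (Submodule.subset_span ⟨i, rfl⟩)
    have hwf : ∀ i, inner ℂ w (f i) = 0 := fun i =>
      Submodule.starProjection_inner_eq_zero _ _ (Submodule.subset_span ⟨i, rfl⟩)
    have hwN : inner ℂ w (N v) = (‖w‖ : ℂ) ^ 2 := by
      have h1 : inner ℂ w (Q (N v)) = 0 :=
        Submodule.starProjection_inner_eq_zero _ _ (Submodule.starProjection_apply_mem _ _)
      have h2 : inner ℂ w w = (‖w‖ : ℂ) ^ 2 := inner_self_eq_norm_sq_to_K (𝕜 := ℂ) w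
      have h3 : N v = w + Q (N v) := by rw [hw, sub_add_cancel]
      rw [h3, inner_add_right, h2, h1, add_zero]
    refine ⟨Fin.snoc e (((‖v‖⁻¹ : ℝ) : ℂ) • v), Fin.snoc f (((‖w‖⁻¹ : ℝ) : ℂ) • w),
      he.fin_snoc ?_ ?_, hf.fin_snoc ?_ ?_, fun j => ?_⟩
    · rw [norm_smul, Complex.norm_real, norm_inv, norm_norm, inv_mul_cancel₀ hv0.ne']
    · intro i; rw [inner_smul_left, hve, mul_zero]
    · rw [norm_smul, Complex.norm_real, norm_inv, norm_norm, inv_mul_cancel₀ hw0.ne']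
    · intro i; rw [inner_smul_left, hwf, mul_zero]
    · induction j using Fin.lastCases with
      | last =>
        simp only [Fin.snoc_last, map_smul, inner_smul_left, inner_smul_right, hwN, norm_mul,
          norm_pow, Complex.norm_real, Complex.conj_ofReal, norm_inv, norm_norm]
        have : ‖v‖⁻¹ * (‖w‖⁻¹ * ‖w‖ ^ 2) = ‖w‖ / ‖v‖ := by field_simp
        rw [this, lt_div_iff₀ hv0]
        exact hvw
      | cast j => simpa [Fin.snoc_castSucc] using hN j

/-- Ky Fan type estimate of a singular value by matrix entries along orthonormal systems. -/
theorem sVal_le_of_sum_inner_le (N : H →L[ℂ] H) {k : ℕ} (hk : 0 < k) {M : ℝ} (hM : 0 ≤ M)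
    (h : ∀ e f : Fin k → H, Orthonormal ℂ e → Orthonormal ℂ f →
      ∑ j, ‖inner ℂ (f j) (N (e j))‖ ≤ k * M) :
    sVal N (2 * (k - 1)) ≤ M := by
  by_contra! hlt
  obtain ⟨e, f, he, hf, hN⟩ := exists_orthonormal_lt_inner N hM k fun j hj =>
    hlt.trans_le (sVal_antitone N (by omega))
  have h1 : ∑ _j : Fin k, M < ∑ j, ‖inner ℂ (f j) (N (e j))‖ :=
    Finset.sum_lt_sum_of_nonempty ⟨⟨0, hk⟩, Finset.mem_univ _⟩ fun j _ => hN j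
  have h2 := h e f he hf
  simp only [Finset.sum_const, Finset.card_univ, Fintype.card_fin, nsmul_eq_mul] at h1
  linarith

theorem exists_sum_rankOne_eq (B : H →L[ℂ] H) {k : ℕ}
    (hB : LinearMap.rank (B : H →ₗ[ℂ] H) ≤ (k : Cardinal)) :
    ∃ n ≤ k, ∃ w x : Fin n → H, (∀ i, ‖w i‖ ≤ 1) ∧ (∀ i, ‖x i‖ ≤ ‖B‖) ∧
      B = ∑ i, rankOne ℂ (w i) (x i) := by
  have hfin : FiniteDimensional ℂ (LinearMap.range (B : H →ₗ[ℂ] H)) :=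
    Module.rank_lt_aleph0_iff.1 (hB.trans_lt (Cardinal.natCast_lt_aleph0))
  set b := stdOrthonormalBasis ℂ (LinearMap.range (B : H →ₗ[ℂ] H))
  have hb : ∀ i, ‖(b i : H)‖ ≤ 1 := fun i => (b.orthonormal.1 i).le
  refine ⟨_, Module.finrank_le_of_rank_le hB, fun i => (b i : H),
    fun i => ContinuousLinearMap.adjoint B (b i : H), hb, fun i => ?_, ?_⟩
  · refine (ContinuousLinearMap.le_opNorm _ _).trans ?_
    rw [LinearIsometryEquiv.norm_map]
    exact mul_le_of_le_one_right (norm_nonneg _) (hb i)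
  · ext z
    have h := b.sum_repr' ⟨B z, z, rfl⟩
    have h2 := congrArg (Subtype.val) h
    simp only [Submodule.coe_sum, Submodule.coe_smul, Submodule.coe_inner] at h2
    simp only [_root_.sum_apply, rankOne_apply,
      ContinuousLinearMap.adjoint_inner_left]
    exact h2.symm

/-- The sum `s_0 + ∑_{i ≤ m} 2^i s_{2^i}`, comparable to the sum of the first `2^m` singular
values. -/
def dyadicSum (A : H →L[ℂ] H) (m : ℕ) : ℝ :=
  sVal A 0 + ∑ i ∈ Finset.range (m + 1), 2 ^ i * sVal A (2 ^ i)

/-- A subadditive functional controlled both by the operator norm and on rank one operators is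
controlled by partial sums of singular values. -/
theorem le_dyadicSum_of_subadditive (E : (H →L[ℂ] H) → ℝ) {K : ℝ} (hK : 0 ≤ K) (m : ℕ)
    (hzero : E 0 ≤ 0)
    (hadd : ∀ A B, E (A + B) ≤ E A + E B)
    (hnorm : ∀ B, E B ≤ K * (2 ^ m * ‖B‖))
    (hone : ∀ x y, E (rankOne ℂ x y) ≤ K * (‖x‖ * ‖y‖)) (A : H →L[ℂ] H) :
    E A ≤ K * (6 * dyadicSum A m) := by
  have hsum : ∀ (n : ℕ) (F : Fin n → (H →L[ℂ] H)), E (∑ i, F i) ≤ ∑ i, E (F i) := by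
    intro n F
    exact Finset.le_sum_of_subadditive E hzero hadd Finset.univ F
  have hrank : ∀ (B : H →L[ℂ] H) (k : ℕ) (b : ℝ),
      LinearMap.rank (B : H →ₗ[ℂ] H) ≤ (k : Cardinal) → ‖B‖ ≤ b → E B ≤ K * (k * b) := by
    intro B k b hBk hBb
    obtain ⟨n, hn, w, x, hw, hx, hB⟩ := exists_sum_rankOne_eq B hBk
    have hb : 0 ≤ b := (norm_nonneg B).trans hBb
    calc E B = E (∑ i, rankOne ℂ (w i) (x i)) := by rw [← hB]
      _ ≤ ∑ i, E (rankOne ℂ (w i) (x i)) := hsum _ _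
      _ ≤ ∑ _i : Fin n, K * b := by
        refine Finset.sum_le_sum fun i _ => (hone _ _).trans ?_
        refine mul_le_mul_of_nonneg_left ?_ hK
        calc ‖w i‖ * ‖x i‖ ≤ 1 * b :=
              mul_le_mul (hw i) ((hx i).trans hBb) (norm_nonneg _) zero_le_one
          _ = b := one_mul b
      _ = n * (K * b) := by simp
      _ ≤ k * (K * b) := by
        have : (n : ℝ) ≤ k := by exact_mod_cast hn
        exact mul_le_mul_of_nonneg_right this (mul_nonneg hK hb)
      _ = K * (k * b) := by ring
  have key : ∀ ε > 0, E A ≤ K * (6 * dyadicSum A m) + ε * (K * (7 * 2 ^ m)) := by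
    intro ε hε
    choose R hRr hRn using fun j => exists_rank_le_norm_sub_lt A j hε
    have hind : ∀ i : ℕ, E (R (2 ^ i)) ≤
        K * (6 * (sVal A 0 + ∑ j ∈ Finset.range i, 2 ^ j * sVal A (2 ^ j)) + 6 * 2 ^ i * ε) := by
      intro i
      induction i with
      | zero =>
        have h1 : ‖R 1‖ ≤ 2 * sVal A 0 + ε := by
          have h2 : ‖R 1‖ ≤ ‖A‖ + ‖A - R 1‖ := by
            simpa using norm_sub_le A (A - R 1)
          have h3 := sVal_antitone A (Nat.zero_le 1)
          linarith [hRn 1, norm_le_sVal_zero A]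
        refine (hrank (R 1) 1 _ (hRr 1) h1).trans (mul_le_mul_of_nonneg_left ?_ hK)
        have := sVal_nonneg A 0
        simp
        linarith
      | succ i ih =>
        have hle : (2 : ℕ) ^ i ≤ 2 ^ (i + 1) := Nat.pow_le_pow_right (by norm_num) (by omega)
        have h1 : ‖R (2 ^ (i + 1)) - R (2 ^ i)‖ ≤ 2 * sVal A (2 ^ i) + 2 * ε := by
          have h2 := norm_sub_le (A - R (2 ^ i)) (A - R (2 ^ (i + 1)))
          have h3 : A - R (2 ^ i) - (A - R (2 ^ (i + 1))) = R (2 ^ (i + 1)) - R (2 ^ i) := by abel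
          rw [h3] at h2
          linarith [hRn (2 ^ i), hRn (2 ^ (i + 1)), sVal_antitone A hle]
        have h4 : LinearMap.rank ((R (2 ^ (i + 1)) - R (2 ^ i) : H →L[ℂ] H) : H →ₗ[ℂ] H) ≤
            ((3 * 2 ^ i : ℕ) : Cardinal) := by
          have h5 := LinearMap.rank_add_le (R (2 ^ (i + 1)) : H →ₗ[ℂ] H)
            ((-1 : ℂ) • (R (2 ^ i) : H →ₗ[ℂ] H))
          have h6 : LinearMap.rank ((-1 : ℂ) • (R (2 ^ i) : H →ₗ[ℂ] H)) ≤
              ((2 ^ i : ℕ) : Cardinal) := by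
            have : ((-1 : ℂ) • (R (2 ^ i) : H →ₗ[ℂ] H)) =
              (R (2 ^ i) : H →ₗ[ℂ] H) ∘ₗ ((-1 : ℂ) • LinearMap.id) := by
              ext; simp
            rw [this]
            exact (LinearMap.rank_comp_le_left _ _).trans (hRr _)
          have h7 : ((R (2 ^ (i + 1)) - R (2 ^ i) : H →L[ℂ] H) : H →ₗ[ℂ] H) =
              (R (2 ^ (i + 1)) : H →ₗ[ℂ] H) + (-1 : ℂ) • (R (2 ^ i) : H →ₗ[ℂ] H) := by
            ext; simp [sub_eq_add_neg]
          rw [h7]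
          refine (h5.trans (add_le_add (hRr _) h6)).trans (le_of_eq ?_)
          rw [← Nat.cast_add]
          congr 1
          ring
        have h8 := hrank _ _ _ h4 h1
        have h9 := hadd (R (2 ^ i)) (R (2 ^ (i + 1)) - R (2 ^ i))
        rw [add_sub_cancel] at h9
        rw [Finset.sum_range_succ]
        push_cast at h8
        calc E (R (2 ^ (i + 1))) ≤ _ := h9
          _ ≤ _ := add_le_add ih h8
          _ = _ := by ring
    have h1 := hadd (R (2 ^ m)) (A - R (2 ^ m))
    rw [add_sub_cancel] at h1
    have h2 : E (A - R (2 ^ m)) ≤ K * (2 ^ m * (sVal A (2 ^ m) + ε)) :=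
      (hnorm _).trans (by gcongr; exact (hRn _).le)
    have h3 : 0 ≤ K * (5 * (2 ^ m * sVal A (2 ^ m))) := by
      have := sVal_nonneg A (2 ^ m)
      positivity
    have h4 := hind m
    rw [dyadicSum, Finset.sum_range_succ]
    nlinarith
  refine le_of_forall_pos_le_add fun δ hδ => ?_
  refine (key (δ / (K * (7 * 2 ^ m) + 1)) (by positivity)).trans ?_
  gcongr
  rw [div_mul_eq_mul_div, div_le_iff₀ (by positivity)]
  have : 0 ≤ K * (7 * 2 ^ m) := by positivity
  nlinarith

end SingularValues

section Resolvent

variable {H : Type} [NormedAddCommGroup H] [InnerProductSpace ℂ H] [CompleteSpace H]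

/-- The inverse of `1 - z S`. -/
def discResolvent (S : H →L[ℂ] H) (z : ℂ) : H →L[ℂ] H := Ring.inverse (1 - z • S)

theorem isUnit_one_sub_smul {S : H →L[ℂ] H} (hS : ‖S‖ < 1) {z : ℂ} (hz : ‖z‖ ≤ 1) :
    IsUnit (1 - z • S) := by
  refine isUnit_one_sub_of_norm_lt_one ?_
  rw [norm_smul]
  exact (mul_le_of_le_one_left (norm_nonneg _) hz).trans_lt hS

theorem discResolvent_mul_cancel {S : H →L[ℂ] H} (hS : ‖S‖ < 1) {z : ℂ} (hz : ‖z‖ ≤ 1) :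
    discResolvent S z * (1 - z • S) = 1 :=
  Ring.inverse_mul_cancel _ (isUnit_one_sub_smul hS hz)

theorem mul_discResolvent_cancel {S : H →L[ℂ] H} (hS : ‖S‖ < 1) {z : ℂ} (hz : ‖z‖ ≤ 1) :
    (1 - z • S) * discResolvent S z = 1 :=
  Ring.mul_inverse_cancel _ (isUnit_one_sub_smul hS hz)

theorem discResolvent_eq_one_add {S : H →L[ℂ] H} (hS : ‖S‖ < 1) {z : ℂ} (hz : ‖z‖ ≤ 1) :
    discResolvent S z = 1 + z • (S * discResolvent S z) := by
  have h := mul_discResolvent_cancel hS hz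
  rw [sub_mul, one_mul, smul_mul_assoc, sub_eq_iff_eq_add] at h
  exact h

theorem adjoint_discResolvent {S : H →L[ℂ] H} (hS : ‖S‖ < 1) {z : ℂ} (hz : ‖z‖ ≤ 1) :
    ContinuousLinearMap.adjoint (discResolvent S z) =
      discResolvent (ContinuousLinearMap.adjoint S) (starRingEnd ℂ z) := by
  have hS' : ‖ContinuousLinearMap.adjoint S‖ < 1 := by
    rwa [LinearIsometryEquiv.norm_map]
  have hz' : ‖starRingEnd ℂ z‖ ≤ 1 := by rwa [RCLike.norm_conj]
  have h := congrArg star (mul_discResolvent_cancel hS hz)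
  simp only [star_mul, star_one, star_sub, star_smul] at h
  have h2 := mul_discResolvent_cancel hS' hz'
  exact left_inv_eq_right_inv h h2

theorem discResolvent_sub {S S' : H →L[ℂ] H} (hS : ‖S‖ < 1) (hS' : ‖S'‖ < 1) {z : ℂ}
    (hz : ‖z‖ ≤ 1) :
    discResolvent S z - discResolvent S' z =
      z • (discResolvent S z * (S - S') * discResolvent S' z) := by
  have h1 : discResolvent S z * ((1 - z • S') - (1 - z • S)) * discResolvent S' z =
      discResolvent S z - discResolvent S' z := by
    rw [mul_sub, sub_mul, mul_assoc, mul_discResolvent_cancel hS' hz, mul_one,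
      discResolvent_mul_cancel hS hz, one_mul]
  rw [← h1]
  have : (1 - z • S') - (1 - z • S) = z • (S - S') := by
    rw [smul_sub]; abel
  rw [this, mul_smul_comm, smul_mul_assoc]

theorem differentiableAt_discResolvent {S : H →L[ℂ] H} (hS : ‖S‖ < 1) {z : ℂ} (hz : ‖z‖ ≤ 1) :
    DifferentiableAt ℂ (discResolvent S) z := by
  obtain ⟨u, hu⟩ := isUnit_one_sub_smul hS hz
  have h1 : DifferentiableAt ℂ (Ring.inverse : (H →L[ℂ] H) → (H →L[ℂ] H)) (1 - z • S) := by
    rw [← hu]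
    exact differentiableAt_inverse u.isUnit
  have h2 : DifferentiableAt ℂ (fun w : ℂ => 1 - w • S) z := by fun_prop
  exact h1.comp z h2

theorem continuousOn_discResolvent {S : H →L[ℂ] H} (hS : ‖S‖ < 1) :
    ContinuousOn (discResolvent S) (Metric.sphere 0 1) := fun z hz =>
  (differentiableAt_discResolvent hS (by simp_all)).continuousAt.continuousWithinAt

theorem continuousOn_inv_sphere : ContinuousOn (fun z : ℂ => z⁻¹) (Metric.sphere 0 1) :=
  continuousOn_inv₀.mono fun z hz h => by simp_all

theorem continuousOn_discResolvent_inv {S : H →L[ℂ] H} (hS : ‖S‖ < 1) :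
    ContinuousOn (fun z => discResolvent S z⁻¹) (Metric.sphere 0 1) :=
  (continuousOn_discResolvent hS).comp continuousOn_inv_sphere fun z hz => by simp_all

theorem circleIntegrable_of_continuousOn {E : Type*} [NormedAddCommGroup E] {f : ℂ → E}
    (hf : ContinuousOn f (Metric.sphere 0 1)) : CircleIntegrable f 0 1 :=
  hf.circleIntegrable zero_le_one

theorem circleAverage_pow_smul_discResolvent {S : H →L[ℂ] H} (hS : ‖S‖ < 1) (n : ℕ) :
    Real.circleAverage (fun z => z ^ n • discResolvent S z) 0 1 = (0 : ℂ) ^ n • 1 := by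
  have h : DiffContOnCl ℂ (fun z : ℂ => z ^ n • discResolvent S z) (Metric.ball 0 |1|) := by
    refine DifferentiableOn.diffContOnCl fun z hz => ?_
    have hz' : ‖z‖ ≤ 1 := by
      rw [closure_ball _ (by simp)] at hz
      simpa using hz
    exact ((differentiableAt_id.pow n).smul
      (differentiableAt_discResolvent hS hz')).differentiableWithinAt
  rw [h.circleAverage]
  simp [discResolvent]

theorem circleAverage_discResolvent {S : H →L[ℂ] H} (hS : ‖S‖ < 1) :
    Real.circleAverage (discResolvent S) 0 1 = 1 := by
  simpa using circleAverage_pow_smul_discResolvent hS 0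

theorem circleAverage_pow_smul_discResolvent_inv {S : H →L[ℂ] H} (hS : ‖S‖ < 1) (n : ℕ) :
    Real.circleAverage (fun z => z ^ n • discResolvent S z⁻¹) 0 1 = S ^ n := by
  induction n with
  | zero =>
    simp only [pow_zero, one_smul]
    rw [Real.circleAverage_zero_one_congr_inv (f := discResolvent S),
      circleAverage_discResolvent hS]
  | succ n ih =>
    have h1 : Real.circleAverage (fun z => z ^ (n + 1) • discResolvent S z⁻¹) 0 1 =
        Real.circleAverage (fun z : ℂ => z ^ (n + 1) • (1 : H →L[ℂ] H) +
          S * (z ^ n • discResolvent S z⁻¹)) 0 1 := by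
      refine Real.circleAverage_congr_sphere fun z hz => ?_
      have hz1 : ‖z‖ = 1 := by simpa using hz
      have hz0 : z ≠ 0 := by rintro rfl; simp at hz1
      have hz' : ‖z⁻¹‖ ≤ 1 := by simp [hz1]
      conv_lhs => rw [discResolvent_eq_one_add hS hz']
      rw [smul_add, smul_smul, mul_smul_comm, pow_succ, mul_assoc, mul_inv_cancel₀ hz0, mul_one]
    have hc : ContinuousOn (fun z : ℂ => z ^ n • discResolvent S z⁻¹) (Metric.sphere 0 1) :=
      (continuous_pow n).continuousOn.smul (continuousOn_discResolvent_inv hS)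
    have h2 : Real.circleAverage (fun z : ℂ => z ^ (n + 1) • (1 : H →L[ℂ] H)) 0 1 = 0 := by
      have h : DiffContOnCl ℂ (fun z : ℂ => z ^ (n + 1) • (1 : H →L[ℂ] H))
          (Metric.ball 0 |1|) :=
        Differentiable.diffContOnCl (by fun_prop)
      rw [h.circleAverage]
      simp
    have h3 := ((ContinuousLinearMap.mul ℂ (H →L[ℂ] H) S).restrictScalars
      ℝ).circleAverage_comp_comm (circleIntegrable_of_continuousOn hc)
    have h4 : Real.circleAverage (fun z : ℂ => S * (z ^ n • discResolvent S z⁻¹)) 0 1 =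
        S ^ (n + 1) := by
      rw [pow_succ', ← ih]
      exact h3
    rw [h1, Real.circleAverage_fun_add, h2, h4, zero_add]
    · exact circleIntegrable_of_continuousOn (by fun_prop)
    · exact circleIntegrable_of_continuousOn (continuousOn_const.mul hc)

theorem circleAverage_eval_smul_discResolvent_inv {S : H →L[ℂ] H} (hS : ‖S‖ < 1)
    (g : Polynomial ℂ) :
    Real.circleAverage (fun z => g.eval z • discResolvent S z⁻¹) 0 1 = Polynomial.aeval S g := by
  have h1 : (fun z : ℂ => g.eval z • discResolvent S z⁻¹) = fun z =>
      ∑ i ∈ Finset.range (g.natDegree + 1), g.coeff i • (z ^ i • discResolvent S z⁻¹) := by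
    funext z
    rw [Polynomial.eval_eq_sum_range, Finset.sum_smul]
    simp only [smul_smul]
  rw [h1, Real.circleAverage_fun_sum, Polynomial.aeval_eq_sum_range]
  · refine Finset.sum_congr rfl fun i _ => ?_
    rw [Real.circleAverage_fun_smul, circleAverage_pow_smul_discResolvent_inv hS]
  · intro i _
    refine circleIntegrable_of_continuousOn ?_
    exact (continuousOn_const (c := g.coeff i)).smul
      ((continuous_pow i).continuousOn.smul (continuousOn_discResolvent_inv hS))

theorem circleAverage_eval_smul_discResolvent {S : H →L[ℂ] H} (hS : ‖S‖ < 1)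
    (g : Polynomial ℂ) :
    Real.circleAverage (fun z => g.eval z • discResolvent S z) 0 1 = g.eval 0 • 1 := by
  have h1 : (fun z : ℂ => g.eval z • discResolvent S z) = fun z =>
      ∑ i ∈ Finset.range (g.natDegree + 1), g.coeff i • (z ^ i • discResolvent S z) := by
    funext z
    rw [Polynomial.eval_eq_sum_range, Finset.sum_smul]
    simp only [smul_smul]
  rw [h1, Real.circleAverage_fun_sum, Polynomial.eval_eq_sum_range, Finset.sum_smul]
  · refine Finset.sum_congr rfl fun i _ => ?_
    rw [Real.circleAverage_fun_smul, circleAverage_pow_smul_discResolvent hS, smul_smul]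
  · intro i _
    refine circleIntegrable_of_continuousOn ?_
    exact (continuousOn_const (c := g.coeff i)).smul
      ((continuous_pow i).continuousOn.smul (continuousOn_discResolvent hS))

/-- The energy identity behind the positivity of the operator Poisson kernel. -/
theorem norm_discResolvent_sq_sub {S : H →L[ℂ] H} (hS : ‖S‖ < 1) {z : ℂ} (hz : ‖z‖ = 1)
    (x : H) :
    ‖discResolvent S z x‖ ^ 2 - ‖S (discResolvent S z x)‖ ^ 2 =
      2 * (inner ℂ x (discResolvent S z x)).re - ‖x‖ ^ 2 := by
  set u := discResolvent S z x with hu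
  have h1 : u - x = z • S u := by
    have h := congrArg (fun A : H →L[ℂ] H => A x) (discResolvent_eq_one_add hS hz.le)
    have h' : u = x + z • S u := h
    exact sub_eq_iff_eq_add'.2 h'
  have h2 : ‖S u‖ = ‖u - x‖ := by rw [h1, norm_smul, hz, one_mul]
  have h3 := norm_sub_sq (𝕜 := ℂ) u x
  have h4 : RCLike.re (inner ℂ u x) = (inner ℂ x u).re := inner_re_symm (𝕜 := ℂ) u x
  rw [h2, h3, h4]
  ring

theorem circleAverage_re_inner_discResolvent {S : H →L[ℂ] H} (hS : ‖S‖ < 1) (x : H) :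
    Real.circleAverage (fun z => (inner ℂ x (discResolvent S z x)).re) 0 1 = ‖x‖ ^ 2 := by
  let L : (H →L[ℂ] H) →L[ℝ] ℝ := Complex.reCLM ∘L
    (((innerSL ℂ x) ∘L (ContinuousLinearMap.apply ℂ H x)).restrictScalars ℝ)
  have h := L.circleAverage_comp_comm
    (circleIntegrable_of_continuousOn (continuousOn_discResolvent hS))
  rw [circleAverage_discResolvent hS] at h
  refine Eq.trans ?_ (h.trans ?_)
  · rfl
  · exact inner_self_eq_norm_sq (𝕜 := ℂ) x

theorem continuousOn_discResolvent_apply {S : H →L[ℂ] H} (hS : ‖S‖ < 1) (x : H) :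
    ContinuousOn (fun z => discResolvent S z x) (Metric.sphere 0 1) :=
  (continuousOn_discResolvent hS).clm_apply continuousOn_const

theorem continuousOn_discResolvent_inv_apply {S : H →L[ℂ] H} (hS : ‖S‖ < 1) (x : H) :
    ContinuousOn (fun z => discResolvent S z⁻¹ x) (Metric.sphere 0 1) :=
  (continuousOn_discResolvent_inv hS).clm_apply continuousOn_const

theorem circleAverage_norm_discResolvent_sq_le {S : H →L[ℂ] H} {r : ℝ} (hS : ‖S‖ ≤ r)
    (hr : r < 1) (x : H) :
    Real.circleAverage (fun z => ‖discResolvent S z x‖ ^ 2) 0 1 ≤ (1 - r ^ 2)⁻¹ * ‖x‖ ^ 2 := by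
  have hS1 : ‖S‖ < 1 := hS.trans_lt hr
  have hr0 : 0 ≤ r := (norm_nonneg S).trans hS
  have hpos : 0 < 1 - r ^ 2 := by nlinarith
  have hcont := continuousOn_discResolvent_apply hS1 x
  have hci : ContinuousOn (fun z => (inner ℂ x (discResolvent S z x)).re)
      (Metric.sphere 0 1) :=
    Complex.continuous_re.comp_continuousOn (ContinuousOn.inner (𝕜 := ℂ) continuousOn_const hcont)
  have h1 : Real.circleAverage (fun z => ‖discResolvent S z x‖ ^ 2) 0 1 ≤
      Real.circleAverage (fun z => (1 - r ^ 2)⁻¹ *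
        (2 * (inner ℂ x (discResolvent S z x)).re - ‖x‖ ^ 2)) 0 1 := by
    refine Real.circleAverage_mono (circleIntegrable_of_continuousOn (hcont.norm.pow 2))
      (circleIntegrable_of_continuousOn (by fun_prop)) fun z hz => ?_
    have hz1 : ‖z‖ = 1 := by simpa using hz
    rw [← norm_discResolvent_sq_sub hS1 hz1, ← div_eq_inv_mul, le_div_iff₀ hpos]
    have h2 : ‖S (discResolvent S z x)‖ ≤ r * ‖discResolvent S z x‖ :=
      S.le_of_opNorm_le hS _
    have h3 := pow_le_pow_left₀ (norm_nonneg _) h2 2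
    nlinarith
  refine h1.trans (le_of_eq ?_)
  have h4 : Real.circleAverage (fun z => (1 - r ^ 2)⁻¹ *
        (2 * (inner ℂ x (discResolvent S z x)).re - ‖x‖ ^ 2)) 0 1 =
      (1 - r ^ 2)⁻¹ * (2 * ‖x‖ ^ 2 - ‖x‖ ^ 2) := by
    have h5 := Real.circleAverage_fun_smul (a := (1 - r ^ 2)⁻¹) (c := 0) (R := 1)
      (f := fun z => 2 * (inner ℂ x (discResolvent S z x)).re - ‖x‖ ^ 2)
    simp only [smul_eq_mul] at h5
    rw [h5, Real.circleAverage_fun_sub, Real.circleAverage_const]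
    · have h6 := Real.circleAverage_fun_smul (a := (2 : ℝ)) (c := 0) (R := 1)
        (f := fun z => (inner ℂ x (discResolvent S z x)).re)
      simp only [smul_eq_mul] at h6
      rw [h6, circleAverage_re_inner_discResolvent hS1]
    · exact circleIntegrable_of_continuousOn (by fun_prop)
    · exact circleIntegrable_of_continuousOn continuousOn_const
  rw [h4]
  ring

theorem circleAverage_norm_mul_norm_le {S S' : H →L[ℂ] H} {r : ℝ} (hS : ‖S‖ ≤ r)
    (hS' : ‖S'‖ ≤ r) (hr : r < 1) (x y : H) :
    Real.circleAverage (fun z => ‖discResolvent S z x‖ * ‖discResolvent S' z⁻¹ y‖) 0 1 ≤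
      (1 - r ^ 2)⁻¹ * (‖x‖ * ‖y‖) := by
  have hS1 : ‖S‖ < 1 := hS.trans_lt hr
  have hS1' : ‖S'‖ < 1 := hS'.trans_lt hr
  rcases eq_or_ne x 0 with rfl | hx
  · simp [Real.circleAverage_const]
  rcases eq_or_ne y 0 with rfl | hy
  · simp [Real.circleAverage_const]
  have hx0 : 0 < ‖x‖ := norm_pos_iff.2 hx
  have hy0 : 0 < ‖y‖ := norm_pos_iff.2 hy
  have hc1 := (continuousOn_discResolvent_apply hS1 x).norm
  have hc2 := (continuousOn_discResolvent_inv_apply hS1' y).norm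
  set a := ‖y‖ / (2 * ‖x‖) with ha
  set b := ‖x‖ / (2 * ‖y‖) with hb
  have h1 : Real.circleAverage (fun z => ‖discResolvent S z x‖ * ‖discResolvent S' z⁻¹ y‖) 0 1 ≤
      Real.circleAverage (fun z => a • ‖discResolvent S z x‖ ^ 2 +
        b • ‖discResolvent S' z⁻¹ y‖ ^ 2) 0 1 := by
    refine Real.circleAverage_mono (circleIntegrable_of_continuousOn (hc1.mul hc2))
      (circleIntegrable_of_continuousOn (by fun_prop)) fun z _ => ?_
    simp only [smul_eq_mul, ha, hb]
    set s := ‖discResolvent S z x‖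
    set t := ‖discResolvent S' z⁻¹ y‖
    have h2 : ‖y‖ / (2 * ‖x‖) * s ^ 2 + ‖x‖ / (2 * ‖y‖) * t ^ 2 - s * t =
        (‖y‖ * s - ‖x‖ * t) ^ 2 / (2 * ‖x‖ * ‖y‖) := by
      field_simp
      ring
    have h3 : 0 ≤ (‖y‖ * s - ‖x‖ * t) ^ 2 / (2 * ‖x‖ * ‖y‖) := by positivity
    linarith
  have h4 := circleAverage_norm_discResolvent_sq_le hS hr x
  have h5 : Real.circleAverage (fun z => ‖discResolvent S' z⁻¹ y‖ ^ 2) 0 1 ≤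
      (1 - r ^ 2)⁻¹ * ‖y‖ ^ 2 := by
    rw [Real.circleAverage_zero_one_congr_inv (f := fun z => ‖discResolvent S' z y‖ ^ 2)]
    exact circleAverage_norm_discResolvent_sq_le hS' hr y
  rw [Real.circleAverage_fun_add (circleIntegrable_of_continuousOn (by fun_prop))
    (circleIntegrable_of_continuousOn (by fun_prop)), Real.circleAverage_fun_smul,
    Real.circleAverage_fun_smul, smul_eq_mul, smul_eq_mul] at h1
  refine h1.trans ((add_le_add (mul_le_mul_of_nonneg_left h4 (by positivity))
    (mul_le_mul_of_nonneg_left h5 (by positivity))).trans (le_of_eq ?_))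
  rw [ha, hb]
  field_simp
  ring

end Resolvent

section VonNeumann

variable {H : Type} [NormedAddCommGroup H] [InnerProductSpace ℂ H] [CompleteSpace H]

theorem re_mul_inner_le_of_nonneg {P : H →L[ℂ] H} (hP : IsSelfAdjoint P)
    (hpos : ∀ h, 0 ≤ (inner ℂ h (P h)).re) {c : ℂ} (hc : ‖c‖ ≤ 1) (x y : H) :
    (c * inner ℂ y (P x)).re ≤ ((inner ℂ x (P x)).re + (inner ℂ y (P y)).re) / 2 := by
  have h1 := hpos (c • x - y)
  have hsym : inner ℂ x (P y) = starRingEnd ℂ (inner ℂ y (P x)) := by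
    rw [inner_conj_symm, ← ContinuousLinearMap.adjoint_inner_left, hP.adjoint_eq]
  have h2 : (inner ℂ (c • x - y) (P (c • x - y))).re =
      ‖c‖ ^ 2 * (inner ℂ x (P x)).re - 2 * (c * inner ℂ y (P x)).re + (inner ℂ y (P y)).re := by
    simp only [map_sub, map_smul, inner_sub_left, inner_sub_right, inner_smul_left,
      inner_smul_right, hsym, ← Complex.normSq_eq_norm_sq]
    simp [Complex.normSq_apply, -inner_conj_symm]
    ring
  have h3 : ‖c‖ ^ 2 * (inner ℂ x (P x)).re ≤ 1 * (inner ℂ x (P x)).re :=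
    mul_le_mul_of_nonneg_right (pow_le_one₀ (norm_nonneg _) hc) (hpos x)
  linarith

/-- The operator Poisson kernel of a strict contraction. -/
def operatorPoisson (S : H →L[ℂ] H) (z : ℂ) : H →L[ℂ] H :=
  discResolvent S z⁻¹ + discResolvent (ContinuousLinearMap.adjoint S) z - 1

theorem discResolvent_adjoint_eq {S : H →L[ℂ] H} (hS : ‖S‖ < 1) {z : ℂ} (hz : ‖z‖ = 1) :
    discResolvent (ContinuousLinearMap.adjoint S) z =
      ContinuousLinearMap.adjoint (discResolvent S z⁻¹) := by
  rw [adjoint_discResolvent hS (by simp [hz]), Complex.inv_eq_conj hz, Complex.conj_conj]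

theorem isSelfAdjoint_operatorPoisson {S : H →L[ℂ] H} (hS : ‖S‖ < 1) {z : ℂ} (hz : ‖z‖ = 1) :
    IsSelfAdjoint (operatorPoisson S z) := by
  rw [operatorPoisson, discResolvent_adjoint_eq hS hz]
  exact (IsSelfAdjoint.add_star_self _).sub (IsSelfAdjoint.one _)

theorem re_inner_operatorPoisson {S : H →L[ℂ] H} (hS : ‖S‖ < 1) {z : ℂ} (hz : ‖z‖ = 1) (x : H) :
    (inner ℂ x (operatorPoisson S z x)).re =
      2 * (inner ℂ x (discResolvent S z⁻¹ x)).re - ‖x‖ ^ 2 := by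
  rw [operatorPoisson, discResolvent_adjoint_eq hS hz]
  have h1 : (inner ℂ x (ContinuousLinearMap.adjoint (discResolvent S z⁻¹) x)).re =
      (inner ℂ x (discResolvent S z⁻¹ x)).re := by
    rw [ContinuousLinearMap.adjoint_inner_right]
    exact inner_re_symm (𝕜 := ℂ) _ _
  have h2 : (inner ℂ x x).re = ‖x‖ ^ 2 := inner_self_eq_norm_sq (𝕜 := ℂ) x
  simp only [_root_.sub_apply, _root_.add_apply, one_apply_eq_self, inner_sub_right,
    inner_add_right, Complex.sub_re, Complex.add_re, h1, h2]
  ring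

theorem re_inner_operatorPoisson_nonneg {S : H →L[ℂ] H} (hS : ‖S‖ < 1) {z : ℂ} (hz : ‖z‖ = 1)
    (x : H) : 0 ≤ (inner ℂ x (operatorPoisson S z x)).re := by
  rw [re_inner_operatorPoisson hS hz, ← norm_discResolvent_sq_sub hS (by simp [hz])]
  have h1 : ‖S (discResolvent S z⁻¹ x)‖ ≤ 1 * ‖discResolvent S z⁻¹ x‖ :=
    S.le_of_opNorm_le hS.le _
  have h2 := pow_le_pow_left₀ (norm_nonneg _) h1 2
  rw [one_mul] at h2
  linarith

theorem norm_adjoint_lt_one {S : H →L[ℂ] H} (hS : ‖S‖ < 1) :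
    ‖ContinuousLinearMap.adjoint S‖ < 1 := by
  rwa [LinearIsometryEquiv.norm_map]

theorem continuousOn_operatorPoisson {S : H →L[ℂ] H} (hS : ‖S‖ < 1) :
    ContinuousOn (operatorPoisson S) (Metric.sphere 0 1) :=
  ((continuousOn_discResolvent_inv hS).add
    (continuousOn_discResolvent (norm_adjoint_lt_one hS))).sub continuousOn_const

theorem circleAverage_re_inner_operatorPoisson {S : H →L[ℂ] H} (hS : ‖S‖ < 1) (x : H) :
    Real.circleAverage (fun z => (inner ℂ x (operatorPoisson S z x)).re) 0 1 = ‖x‖ ^ 2 := by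
  have h1 : Real.circleAverage (fun z => (inner ℂ x (operatorPoisson S z x)).re) 0 1 =
      Real.circleAverage (fun z => (2 : ℝ) • (inner ℂ x (discResolvent S z⁻¹ x)).re - ‖x‖ ^ 2)
        0 1 :=
    Real.circleAverage_congr_sphere fun z hz =>
      re_inner_operatorPoisson hS (by simpa using hz) x
  have hc : ContinuousOn (fun z => (inner ℂ x (discResolvent S z⁻¹ x)).re) (Metric.sphere 0 1) :=
    Complex.continuous_re.comp_continuousOn (ContinuousOn.inner (𝕜 := ℂ) continuousOn_const
      (continuousOn_discResolvent_inv_apply hS x))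
  rw [h1, Real.circleAverage_fun_sub (circleIntegrable_of_continuousOn (by fun_prop))
    (circleIntegrable_of_continuousOn (by fun_prop)), Real.circleAverage_const,
    Real.circleAverage_fun_smul,
    Real.circleAverage_zero_one_congr_inv (f := fun z => (inner ℂ x (discResolvent S z x)).re),
    circleAverage_re_inner_discResolvent hS, smul_eq_mul]
  ring

theorem circleAverage_eval_smul_operatorPoisson {S : H →L[ℂ] H} (hS : ‖S‖ < 1)
    (g : Polynomial ℂ) :
    Real.circleAverage (fun z => g.eval z • operatorPoisson S z) 0 1 = Polynomial.aeval S g := by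
  have hc1 : ContinuousOn (fun z => g.eval z • discResolvent S z⁻¹) (Metric.sphere 0 1) :=
    g.continuous.continuousOn.smul (continuousOn_discResolvent_inv hS)
  have hc2 : ContinuousOn (fun z => g.eval z • discResolvent (ContinuousLinearMap.adjoint S) z)
      (Metric.sphere 0 1) :=
    g.continuous.continuousOn.smul (continuousOn_discResolvent (norm_adjoint_lt_one hS))
  have hc3 : ContinuousOn (fun z => g.eval z • (1 : H →L[ℂ] H)) (Metric.sphere 0 1) :=
    g.continuous.continuousOn.smul continuousOn_const
  have h3 : Real.circleAverage (fun z => g.eval z • (1 : H →L[ℂ] H)) 0 1 = g.eval 0 • 1 := by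
    have h : DiffContOnCl ℂ (fun z : ℂ => g.eval z • (1 : H →L[ℂ] H)) (Metric.ball 0 |1|) :=
      Differentiable.diffContOnCl (g.differentiable.smul_const _)
    exact h.circleAverage
  have hc12 : ContinuousOn (fun z => g.eval z • discResolvent S z⁻¹ +
      g.eval z • discResolvent (ContinuousLinearMap.adjoint S) z) (Metric.sphere 0 1) :=
    hc1.add hc2
  simp only [operatorPoisson, smul_sub, smul_add]
  rw [Real.circleAverage_fun_sub (circleIntegrable_of_continuousOn hc12)
    (circleIntegrable_of_continuousOn hc3), Real.circleAverage_fun_add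
    (circleIntegrable_of_continuousOn hc1) (circleIntegrable_of_continuousOn hc2), h3,
    circleAverage_eval_smul_discResolvent (norm_adjoint_lt_one hS),
    circleAverage_eval_smul_discResolvent_inv hS, add_sub_cancel_right]

theorem norm_aeval_le_of_norm_lt_one {S : H →L[ℂ] H} (hS : ‖S‖ < 1) (g : Polynomial ℂ) {M : ℝ}
    (hM : 0 < M) (hg : ∀ z : ℂ, ‖z‖ = 1 → ‖g.eval z‖ ≤ M) : ‖Polynomial.aeval S g‖ ≤ M := by
  have key : ∀ x y : H, (inner ℂ y (Polynomial.aeval S g x)).re ≤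
      M * ((‖x‖ ^ 2 + ‖y‖ ^ 2) / 2) := by
    intro x y
    have hc : ContinuousOn (fun z => g.eval z • operatorPoisson S z) (Metric.sphere 0 1) :=
      g.continuous.continuousOn.smul (continuousOn_operatorPoisson hS)
    have hq : ∀ x, ContinuousOn (fun z => (inner ℂ x (operatorPoisson S z x)).re)
        (Metric.sphere 0 1) := fun x =>
      Complex.continuous_re.comp_continuousOn (ContinuousOn.inner (𝕜 := ℂ) continuousOn_const
        ((continuousOn_operatorPoisson hS).clm_apply continuousOn_const))
    let L : (H →L[ℂ] H) →L[ℝ] ℝ := Complex.reCLM ∘L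
      (((innerSL ℂ y) ∘L (ContinuousLinearMap.apply ℂ H x)).restrictScalars ℝ)
    have h := L.circleAverage_comp_comm (circleIntegrable_of_continuousOn hc)
    rw [circleAverage_eval_smul_operatorPoisson hS] at h
    have h1 : Real.circleAverage (L ∘ fun z => g.eval z • operatorPoisson S z) 0 1 ≤
        Real.circleAverage (fun z => (M / 2) • ((inner ℂ x (operatorPoisson S z x)).re +
          (inner ℂ y (operatorPoisson S z y)).re)) 0 1 := by
      have hq1 := hq x
      have hq2 := hq y
      refine Real.circleAverage_mono
        (circleIntegrable_of_continuousOn (L.continuous.comp_continuousOn hc))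
        (circleIntegrable_of_continuousOn (by fun_prop)) fun z hz => ?_
      have hz1 : ‖z‖ = 1 := by simpa using hz
      have hcz : ‖g.eval z / (M : ℂ)‖ ≤ 1 := by
        rw [norm_div, Complex.norm_real, Real.norm_of_nonneg hM.le, div_le_one hM]
        exact hg z hz1
      have h2 := re_mul_inner_le_of_nonneg (isSelfAdjoint_operatorPoisson hS hz1)
        (re_inner_operatorPoisson_nonneg hS hz1) hcz x y
      have h3 : L (g.eval z • operatorPoisson S z) =
          M * (g.eval z / (M : ℂ) * inner ℂ y (operatorPoisson S z x)).re := by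
        have h4 : L (g.eval z • operatorPoisson S z) =
            (inner ℂ y (g.eval z • operatorPoisson S z x)).re := rfl
        rw [h4, inner_smul_right, ← Complex.re_ofReal_mul, ← mul_assoc,
          mul_div_cancel₀ _ (by exact_mod_cast hM.ne')]
      simp only [Function.comp_apply, h3, smul_eq_mul]
      calc _ ≤ M * _ := mul_le_mul_of_nonneg_left h2 hM.le
        _ = _ := by ring
    rw [h, Real.circleAverage_fun_smul, Real.circleAverage_fun_add
      (circleIntegrable_of_continuousOn (hq x)) (circleIntegrable_of_continuousOn (hq y)),
      circleAverage_re_inner_operatorPoisson hS, circleAverage_re_inner_operatorPoisson hS,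
      smul_eq_mul] at h1
    calc _ ≤ _ := h1
      _ = _ := by ring
  refine ContinuousLinearMap.opNorm_le_bound _ hM.le fun x => ?_
  set w := Polynomial.aeval S g x
  rcases eq_or_ne x 0 with hx | hx
  · have : w = 0 := by simp [w, hx]
    simp [this, hx]
  rcases eq_or_ne w 0 with hw | hw
  · rw [hw, norm_zero]
    positivity
  have hx0 : 0 < ‖x‖ := norm_pos_iff.2 hx
  have hw0 : 0 < ‖w‖ := norm_pos_iff.2 hw
  have h1 := key x (((‖x‖ / ‖w‖ : ℝ) : ℂ) • w)
  have h2 : (inner ℂ w w).re = ‖w‖ ^ 2 := inner_self_eq_norm_sq (𝕜 := ℂ) w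
  rw [inner_smul_left, Complex.conj_ofReal, Complex.re_ofReal_mul, h2, norm_smul,
    Complex.norm_real, Real.norm_of_nonneg (by positivity), div_mul_cancel₀ _ hw0.ne'] at h1
  have h3 : ‖x‖ / ‖w‖ * ‖w‖ ^ 2 = ‖x‖ * ‖w‖ := by field_simp
  rw [h3] at h1
  refine le_of_mul_le_mul_left ?_ hx0
  calc _ ≤ _ := h1
    _ = _ := by ring

/-- **Von Neumann's inequality.** -/
theorem norm_aeval_le_of_norm_le_one {T : H →L[ℂ] H} (hT : ‖T‖ ≤ 1) (g : Polynomial ℂ) {M : ℝ}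
    (hM : 0 < M) (hg : ∀ z : ℂ, ‖z‖ = 1 → ‖g.eval z‖ ≤ M) : ‖Polynomial.aeval T g‖ ≤ M := by
  have hcont : Continuous fun r : ℝ => ‖Polynomial.aeval ((r : ℂ) • T) g‖ :=
    ((Polynomial.continuous_aeval g).comp (by fun_prop)).norm
  have hlim : Tendsto (fun r : ℝ => ‖Polynomial.aeval ((r : ℂ) • T) g‖) (𝓝[<] 1)
      (𝓝 ‖Polynomial.aeval T g‖) := by
    have := (hcont.tendsto 1).mono_left (nhdsWithin_le_nhds (s := Set.Iio 1))
    simpa using this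
  refine le_of_tendsto hlim ?_
  filter_upwards [Ioo_mem_nhdsLT (zero_lt_one (α := ℝ))] with r hr
  refine norm_aeval_le_of_norm_lt_one ?_ g hM hg
  rw [norm_smul, Complex.norm_real, Real.norm_of_nonneg hr.1.le]
  exact (mul_le_of_le_one_right hr.1.le hT).trans_lt hr.2

end VonNeumann

section Bernstein

theorem norm_circleAverage_le {E : Type*} [NormedAddCommGroup E] [NormedSpace ℝ E] (f : ℂ → E)
    (c : ℂ) (R : ℝ) :
    ‖Real.circleAverage f c R‖ ≤ Real.circleAverage (fun z => ‖f z‖) c R := by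
  rw [Real.circleAverage, Real.circleAverage, norm_smul, smul_eq_mul,
    Real.norm_of_nonneg (by positivity)]
  gcongr
  exact intervalIntegral.norm_integral_le_integral_norm (by positivity)

theorem sum_norm_inner_mul_le {H : Type} [NormedAddCommGroup H]
    [InnerProductSpace ℂ H] {k : ℕ} {e f : Fin k → H} (he : Orthonormal ℂ e)
    (hf : Orthonormal ℂ f) (x y : H) :
    ∑ j, ‖inner ℂ (f j) x‖ * ‖inner ℂ (e j) y‖ ≤ ‖x‖ * ‖y‖ := by
  refine (Real.sum_mul_le_sqrt_mul_sqrt _ _ _).trans ?_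
  gcongr
  · exact Real.sqrt_le_iff.2 ⟨norm_nonneg _, hf.sum_inner_products_le x⟩
  · exact Real.sqrt_le_iff.2 ⟨norm_nonneg _, he.sum_inner_products_le y⟩

variable {H : Type} [NormedAddCommGroup H] [InnerProductSpace ℂ H] [CompleteSpace H]

theorem aeval_sub_aeval_eq_circleAverage {S S' : H →L[ℂ] H} (hS : ‖S‖ < 1) (hS' : ‖S'‖ < 1)
    (g : Polynomial ℂ) :
    Polynomial.aeval S g - Polynomial.aeval S' g = Real.circleAverage (fun z =>
      (g.eval z * z⁻¹) • (discResolvent S z⁻¹ * (S - S') * discResolvent S' z⁻¹)) 0 1 := by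
  have hc : ∀ {S : H →L[ℂ] H}, ‖S‖ < 1 →
      CircleIntegrable (fun z => g.eval z • discResolvent S z⁻¹) 0 1 := fun hS =>
    circleIntegrable_of_continuousOn
      (g.continuous.continuousOn.smul (continuousOn_discResolvent_inv hS))
  rw [← circleAverage_eval_smul_discResolvent_inv hS, ← circleAverage_eval_smul_discResolvent_inv
    hS', ← Real.circleAverage_fun_sub (hc hS) (hc hS')]
  refine Real.circleAverage_congr_sphere fun z hz => ?_
  have hz1 : ‖z‖ = 1 := by simpa using hz
  simp only [← smul_sub]
  rw [discResolvent_sub hS hS' (by simp [hz1]), smul_smul]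

/-- Average over the circle of the diagonal of `(1 - S / z)⁻¹ B (1 - S' / z)⁻¹` relative to two
finite families of vectors. -/
def resolventDiagonal (S S' : H →L[ℂ] H) {k : ℕ} (e f : Fin k → H) (B : H →L[ℂ] H) : ℝ :=
  Real.circleAverage (fun z =>
    ∑ j, ‖inner ℂ (f j) (discResolvent S z⁻¹ (B (discResolvent S' z⁻¹ (e j))))‖) 0 1

theorem continuousOn_inner_resolvent {S S' : H →L[ℂ] H} (hS : ‖S‖ < 1) (hS' : ‖S'‖ < 1)
    (B : H →L[ℂ] H) (x y : H) :
    ContinuousOn (fun z => inner ℂ y (discResolvent S z⁻¹ (B (discResolvent S' z⁻¹ x))))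
      (Metric.sphere 0 1) :=
  ContinuousOn.inner (𝕜 := ℂ) continuousOn_const ((continuousOn_discResolvent_inv hS).clm_apply
    (B.continuous.comp_continuousOn (continuousOn_discResolvent_inv_apply hS' x)))

theorem continuousOn_sum_norm_inner_resolvent {S S' : H →L[ℂ] H} (hS : ‖S‖ < 1) (hS' : ‖S'‖ < 1)
    {k : ℕ} (e f : Fin k → H) (B : H →L[ℂ] H) :
    ContinuousOn (fun z =>
      ∑ j, ‖inner ℂ (f j) (discResolvent S z⁻¹ (B (discResolvent S' z⁻¹ (e j))))‖)
      (Metric.sphere 0 1) :=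
  continuousOn_finsetSum _ fun j _ => (continuousOn_inner_resolvent hS hS' B (e j) (f j)).norm

theorem resolventDiagonal_add_le {S S' : H →L[ℂ] H} (hS : ‖S‖ < 1) (hS' : ‖S'‖ < 1)
    {k : ℕ} (e f : Fin k → H) (A B : H →L[ℂ] H) :
    resolventDiagonal S S' e f (A + B) ≤
      resolventDiagonal S S' e f A + resolventDiagonal S S' e f B := by
  have hc := continuousOn_sum_norm_inner_resolvent hS hS' e f
  have hcAB : ContinuousOn (fun z =>
      ∑ j, ‖inner ℂ (f j) (discResolvent S z⁻¹ (A (discResolvent S' z⁻¹ (e j))))‖ +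
      ∑ j, ‖inner ℂ (f j) (discResolvent S z⁻¹ (B (discResolvent S' z⁻¹ (e j))))‖)
      (Metric.sphere 0 1) := (hc A).add (hc B)
  rw [resolventDiagonal, resolventDiagonal, resolventDiagonal, ← Real.circleAverage_fun_add
    (circleIntegrable_of_continuousOn (hc A)) (circleIntegrable_of_continuousOn (hc B))]
  refine Real.circleAverage_mono (circleIntegrable_of_continuousOn (hc _))
    (circleIntegrable_of_continuousOn hcAB) fun z _ => ?_
  simp only [← Finset.sum_add_distrib]
  refine Finset.sum_le_sum fun j _ => ?_
  rw [_root_.add_apply, map_add, inner_add_right]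
  exact norm_add_le _ _

theorem continuousOn_norm_mul_norm {S S' : H →L[ℂ] H} (hS : ‖S‖ < 1) (hS' : ‖S'‖ < 1)
    (x y : H) : ContinuousOn (fun z => ‖discResolvent S z x‖ * ‖discResolvent S' z⁻¹ y‖)
      (Metric.sphere 0 1) :=
  (continuousOn_discResolvent_apply hS x).norm.mul (continuousOn_discResolvent_inv_apply hS' y).norm

theorem resolventDiagonal_le_norm {S S' : H →L[ℂ] H} {r : ℝ} (hS : ‖S‖ ≤ r) (hS' : ‖S'‖ ≤ r)
    (hr : r < 1) {k : ℕ} {e f : Fin k → H} (he : ∀ j, ‖e j‖ = 1) (hf : ∀ j, ‖f j‖ = 1)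
    (B : H →L[ℂ] H) :
    resolventDiagonal S S' e f B ≤ (1 - r ^ 2)⁻¹ * (k * ‖B‖) := by
  have hS1 := hS.trans_lt hr
  have hS1' := hS'.trans_lt hr
  have hadj : ‖ContinuousLinearMap.adjoint S‖ ≤ r := by rwa [LinearIsometryEquiv.norm_map]
  have hc := fun j => continuousOn_norm_mul_norm (norm_adjoint_lt_one hS1) hS1' (f j) (e j)
  have hcs : ContinuousOn (fun z => ∑ j, ‖B‖ • (‖discResolvent (ContinuousLinearMap.adjoint S) z
      (f j)‖ * ‖discResolvent S' z⁻¹ (e j)‖)) (Metric.sphere 0 1) :=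
    continuousOn_finsetSum _ fun j _ => (hc j).const_smul ‖B‖
  calc resolventDiagonal S S' e f B
      ≤ Real.circleAverage (fun z => ∑ j, ‖B‖ • (‖discResolvent (ContinuousLinearMap.adjoint S) z
          (f j)‖ * ‖discResolvent S' z⁻¹ (e j)‖)) 0 1 := by
        refine Real.circleAverage_mono (circleIntegrable_of_continuousOn
          (continuousOn_sum_norm_inner_resolvent hS1 hS1' e f B))
          (circleIntegrable_of_continuousOn hcs) fun z hz => Finset.sum_le_sum fun j _ => ?_
        have hz1 : ‖z‖ = 1 := by simpa using hz
        rw [← ContinuousLinearMap.adjoint_inner_left, ← discResolvent_adjoint_eq hS1 hz1]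
        refine (norm_inner_le_norm _ _).trans ?_
        rw [smul_eq_mul, mul_left_comm]
        exact mul_le_mul_of_nonneg_left (B.le_opNorm _) (norm_nonneg _)
    _ = ∑ j, ‖B‖ * Real.circleAverage (fun z => ‖discResolvent (ContinuousLinearMap.adjoint S) z
          (f j)‖ * ‖discResolvent S' z⁻¹ (e j)‖) 0 1 := by
        refine (Real.circleAverage_fun_sum fun j _ => circleIntegrable_of_continuousOn
          ((hc j).const_smul ‖B‖)).trans (Finset.sum_congr rfl fun j _ => ?_)
        rw [Real.circleAverage_smul, smul_eq_mul]
    _ ≤ ∑ _j : Fin k, ‖B‖ * (1 - r ^ 2)⁻¹ := by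
        refine Finset.sum_le_sum fun j _ => mul_le_mul_of_nonneg_left ?_ (norm_nonneg _)
        have := circleAverage_norm_mul_norm_le hadj hS' hr (f j) (e j)
        rwa [he, hf, mul_one, mul_one] at this
    _ = _ := by
        rw [Finset.sum_const, Finset.card_univ, Fintype.card_fin, nsmul_eq_mul]
        ring

theorem resolventDiagonal_rankOne_le {S S' : H →L[ℂ] H} {r : ℝ} (hS : ‖S‖ ≤ r) (hS' : ‖S'‖ ≤ r)
    (hr : r < 1) {k : ℕ} {e f : Fin k → H} (he : Orthonormal ℂ e) (hf : Orthonormal ℂ f)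
    (x y : H) :
    resolventDiagonal S S' e f (rankOne ℂ x y) ≤ (1 - r ^ 2)⁻¹ * (‖x‖ * ‖y‖) := by
  have hS1 := hS.trans_lt hr
  have hS1' := hS'.trans_lt hr
  have hadj : ‖ContinuousLinearMap.adjoint S'‖ ≤ r := by rwa [LinearIsometryEquiv.norm_map]
  rw [mul_comm ‖x‖]
  refine le_trans ?_ (circleAverage_norm_mul_norm_le hadj hS hr y x)
  refine Real.circleAverage_mono (circleIntegrable_of_continuousOn
    (continuousOn_sum_norm_inner_resolvent hS1 hS1' e f _))
    (circleIntegrable_of_continuousOn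
      (continuousOn_norm_mul_norm (norm_adjoint_lt_one hS1') hS1 y x)) fun z hz => ?_
  have hz1 : ‖z‖ = 1 := by simpa using hz
  simp only [discResolvent_adjoint_eq hS1' hz1]
  rw [mul_comm]
  refine le_trans (le_of_eq ?_) (sum_norm_inner_mul_le he hf _ _)
  refine Finset.sum_congr rfl fun j _ => ?_
  rw [rankOne_apply, map_smul, inner_smul_right, norm_mul, mul_comm,
    ContinuousLinearMap.adjoint_inner_right, norm_inner_symm y]

/-- A Bernstein type inequality for the Ky Fan norms of differences of polynomials of two
contractions. -/
theorem sum_norm_inner_aeval_sub_le {T R : H →L[ℂ] H} (hT : ‖T‖ ≤ 1) (hR : ‖R‖ ≤ 1) {r : ℝ}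
    (hr0 : 0 ≤ r) (hr : r < 1) (g : Polynomial ℂ) {M : ℝ}
    (hg : ∀ z : ℂ, ‖z‖ = 1 → ‖g.eval z‖ ≤ M) (m : ℕ) {e f : Fin (2 ^ m) → H}
    (he : Orthonormal ℂ e) (hf : Orthonormal ℂ f) :
    ∑ j, ‖inner ℂ (f j)
      ((Polynomial.aeval ((r : ℂ) • T) g - Polynomial.aeval ((r : ℂ) • R) g) (e j))‖ ≤
      M * ((1 - r ^ 2)⁻¹ * (6 * dyadicSum (T - R) m)) := by
  have hM : 0 ≤ M := (norm_nonneg _).trans (hg 1 (by simp))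
  have hnorm : ∀ {T : H →L[ℂ] H}, ‖T‖ ≤ 1 → ‖(r : ℂ) • T‖ ≤ r := fun {T} hT => by
    rw [norm_smul, Complex.norm_real, Real.norm_of_nonneg hr0]
    exact mul_le_of_le_one_right hr0 hT
  set S := (r : ℂ) • T with hSdef
  set S' := (r : ℂ) • R with hSdef'
  have hS : ‖S‖ ≤ r := hnorm hT
  have hS' : ‖S'‖ ≤ r := hnorm hR
  have hS1 := hS.trans_lt hr
  have hS1' := hS'.trans_lt hr
  have hK : 0 ≤ (1 - r ^ 2)⁻¹ := inv_nonneg.2 (by nlinarith)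
  have hdiff : S - S' = (r : ℂ) • (T - R) := (smul_sub _ _ _).symm
  have hE : resolventDiagonal S S' e f (T - R) ≤ (1 - r ^ 2)⁻¹ * (6 * dyadicSum (T - R) m) := by
    refine le_dyadicSum_of_subadditive (resolventDiagonal S S' e f) hK m ?_
      (resolventDiagonal_add_le hS1 hS1' e f) (fun B => ?_)
      (resolventDiagonal_rankOne_le hS hS' hr he hf) _
    · simp [resolventDiagonal, Real.circleAverage_const]
    · exact_mod_cast resolventDiagonal_le_norm hS hS' hr he.1 hf.1 B
  refine le_trans ?_ (mul_le_mul_of_nonneg_left hE hM)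
  have hc := continuousOn_inner_resolvent hS1 hS1' (T - R)
  have hop : ContinuousOn (fun z => (g.eval z * z⁻¹) •
      (discResolvent S z⁻¹ * (S - S') * discResolvent S' z⁻¹)) (Metric.sphere 0 1) :=
    (g.continuous.continuousOn.mul continuousOn_inv_sphere).smul
      (((continuousOn_discResolvent_inv hS1).mul continuousOn_const).mul
        (continuousOn_discResolvent_inv hS1'))
  have hterm : ∀ j, ‖inner ℂ (f j) ((Polynomial.aeval S g - Polynomial.aeval S' g) (e j))‖ ≤
      M * Real.circleAverage (fun z =>
        ‖inner ℂ (f j) (discResolvent S z⁻¹ ((T - R) (discResolvent S' z⁻¹ (e j))))‖) 0 1 := by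
    intro j
    let L : (H →L[ℂ] H) →L[ℝ] ℂ :=
      ((innerSL ℂ (f j)) ∘L (ContinuousLinearMap.apply ℂ H (e j))).restrictScalars ℝ
    have h := L.circleAverage_comp_comm (circleIntegrable_of_continuousOn hop)
    rw [← aeval_sub_aeval_eq_circleAverage hS1 hS1'] at h
    change ‖L (Polynomial.aeval S g - Polynomial.aeval S' g)‖ ≤ _
    rw [← h, ← smul_eq_mul, ← Real.circleAverage_fun_smul]
    refine (norm_circleAverage_le _ _ _).trans (Real.circleAverage_mono
      (circleIntegrable_of_continuousOn (L.continuous.comp_continuousOn hop).norm)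
      (circleIntegrable_of_continuousOn ((hc (e j) (f j)).norm.const_smul M)) fun z hz => ?_)
    have hz1 : ‖z‖ = 1 := by simpa using hz
    have h4 : (L ∘ fun z => (g.eval z * z⁻¹) •
        (discResolvent S z⁻¹ * (S - S') * discResolvent S' z⁻¹)) z =
        inner ℂ (f j) ((g.eval z * z⁻¹) •
          discResolvent S z⁻¹ ((S - S') (discResolvent S' z⁻¹ (e j)))) := rfl
    rw [h4, hdiff, _root_.smul_apply, map_smul, smul_smul, inner_smul_right, norm_mul, norm_mul,
      norm_mul, norm_inv, hz1, inv_one, mul_one, Complex.norm_real, Real.norm_of_nonneg hr0,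
      smul_eq_mul]
    refine mul_le_mul_of_nonneg_right ?_ (norm_nonneg _)
    calc _ ≤ M * 1 := mul_le_mul (hg z hz1) hr.le hr0 hM
      _ = M := mul_one M
  refine (Finset.sum_le_sum fun j _ => hterm j).trans_eq ?_
  rw [← Finset.mul_sum, resolventDiagonal, Real.circleAverage_fun_sum fun j _ =>
    circleIntegrable_of_continuousOn (hc (e j) (f j)).norm]

end Bernstein

section DiskAlgebra

theorem norm_one_sub_le_of_re_le_one {w : ℂ} (hw : w.re ≤ 1) {ε : ℝ} (hε : 0 ≤ ε) :
    ‖1 - w‖ ≤ ‖1 + (ε : ℂ) - w‖ := by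
  rw [← sq_le_sq₀ (norm_nonneg _) (norm_nonneg _), ← Complex.normSq_eq_norm_sq,
    ← Complex.normSq_eq_norm_sq, Complex.normSq_apply, Complex.normSq_apply]
  simp only [Complex.sub_re, Complex.sub_im, Complex.add_re, Complex.add_im, Complex.one_re,
    Complex.one_im, Complex.ofReal_re, Complex.ofReal_im]
  nlinarith

theorem norm_sub_eq_norm_one_sub_mul_conj {z τ : ℂ} (hτ : ‖τ‖ = 1) :
    ‖z - τ‖ = ‖1 - z * starRingEnd ℂ τ‖ := by
  have h : z - τ = -(τ * (1 - z * starRingEnd ℂ τ)) := by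
    have : τ * starRingEnd ℂ τ = 1 := by
      rw [Complex.mul_conj, Complex.normSq_eq_norm_sq, hτ]
      simp
    linear_combination z * (-this)
  rw [h, norm_neg, norm_mul, hτ, one_mul]

/-- A Hölder estimate for the boundary values of a function of the disk algebra extends to the
closed disk. -/
theorem HoelderCircleWith.norm_sub_le {C α : ℝ} {f : ℂ → ℂ} (hα : 0 < α)
    (hf : HoelderCircleWith C α f) (hd : DifferentiableOn ℂ f (Metric.ball 0 1))
    (hc : ContinuousOn f (Metric.closedBall 0 1)) {z τ : ℂ} (hz : ‖z‖ ≤ 1) (hτ : ‖τ‖ = 1) :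
    ‖f z - f τ‖ ≤ C * ‖z - τ‖ ^ α := by
  have hre : ∀ {w : ℂ}, ‖w‖ ≤ 1 → (w * starRingEnd ℂ τ).re ≤ 1 := fun {w} hw => by
    refine (Complex.re_le_norm _).trans ?_
    rw [norm_mul, RCLike.norm_conj, hτ, mul_one]
    exact hw
  have key : ∀ ε : ℝ, 0 < ε →
      ‖f z - f τ‖ ≤ C * ‖1 + (ε : ℂ) - z * starRingEnd ℂ τ‖ ^ α := by
    intro ε hε
    have hpos : ∀ {w : ℂ}, ‖w‖ ≤ 1 → 0 < (1 + (ε : ℂ) - w * starRingEnd ℂ τ).re := by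
      intro w hw
      have := hre hw
      simp only [Complex.sub_re, Complex.add_re, Complex.one_re, Complex.ofReal_re]
      linarith
    have hnorm : ∀ {w : ℂ}, ‖w‖ ≤ 1 → 0 < ‖1 + (ε : ℂ) - w * starRingEnd ℂ τ‖ := fun hw =>
      (hpos hw).trans_le (Complex.re_le_norm _)
    let h : ℂ → ℂ := fun w =>
      (f w - f τ) * (1 + (ε : ℂ) - w * starRingEnd ℂ τ) ^ ((-α : ℝ) : ℂ)
    have hh : ∀ w, ‖w‖ ≤ 1 →
        ‖h w‖ = ‖f w - f τ‖ / ‖1 + (ε : ℂ) - w * starRingEnd ℂ τ‖ ^ α := fun w hw => by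
      simp only [h]
      rw [norm_mul, Complex.norm_cpow_real, Real.rpow_neg (norm_nonneg _), div_eq_mul_inv]
    have hdc : DiffContOnCl ℂ h (Metric.ball 0 1) := by
      refine ⟨(hd.sub_const _).mul (DifferentiableOn.cpow_const (by fun_prop) fun w hw => ?_), ?_⟩
      · exact Or.inl (hpos (by simpa using (Metric.mem_ball.1 hw).le))
      · rw [closure_ball _ one_ne_zero]
        refine (hc.sub continuousOn_const).mul
          (ContinuousOn.cpow_const (by fun_prop) fun w hw => ?_)
        exact Or.inl (hpos (by simpa using hw))
    have hmax : ‖h z‖ ≤ C := by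
      refine Complex.norm_le_of_forall_mem_frontier_norm_le Metric.isBounded_ball hdc
        (fun w hw => ?_) (by rw [closure_ball _ one_ne_zero]; simpa using hz)
      rw [frontier_ball _ one_ne_zero] at hw
      have hw1 : ‖w‖ = 1 := by simpa using hw
      rw [hh w hw1.le, div_le_iff₀ (Real.rpow_pos_of_pos (hnorm hw1.le) _)]
      refine (hf w τ hw1 hτ).trans ?_
      have hC : 0 ≤ C := by
        have h1 := (norm_nonneg _).trans (hf 1 (-1) (by simp) (by simp))
        have h2 : (0 : ℝ) < ‖(1 : ℂ) - -1‖ ^ α := Real.rpow_pos_of_pos (by norm_num) _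
        exact nonneg_of_mul_nonneg_left h1 h2
      rw [norm_sub_eq_norm_one_sub_mul_conj hτ]
      gcongr
      exact norm_one_sub_le_of_re_le_one (hre hw1.le) hε.le
    rwa [hh z hz, div_le_iff₀ (Real.rpow_pos_of_pos (hnorm hz) _)] at hmax
  have hlim : Tendsto (fun ε : ℝ => C * ‖1 + (ε : ℂ) - z * starRingEnd ℂ τ‖ ^ α) (𝓝[>] 0)
      (𝓝 (C * ‖z - τ‖ ^ α)) := by
    have hcont : Continuous fun ε : ℝ => C * ‖1 + (ε : ℂ) - z * starRingEnd ℂ τ‖ ^ α := by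
      refine continuous_const.mul (Continuous.rpow_const (by fun_prop) fun _ => Or.inr hα.le)
    have := (hcont.tendsto 0).mono_left (nhdsWithin_le_nhds (s := Set.Ioi 0))
    rw [norm_sub_eq_norm_one_sub_mul_conj hτ]
    simpa using this
  exact ge_of_tendsto hlim (by filter_upwards [self_mem_nhdsWithin] with ε hε using key ε hε)

theorem hoelderCircleNorm_nonneg (α : ℝ) (f : ℂ → ℂ) : 0 ≤ hoelderCircleNorm α f :=
  Real.sInf_nonneg fun _ h => h.1

theorem MemHoelderCircle.hoelderCircleWith {α : ℝ} (hα : 0 < α) {f : ℂ → ℂ}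
    (hf : MemHoelderCircle α f) :
    HoelderCircleWith (hoelderCircleNorm α f) α f := by
  intro ζ τ hζ hτ
  rcases eq_or_ne ζ τ with h | h
  · simp [h, Real.zero_rpow hα.ne']
  have hpos : 0 < ‖ζ - τ‖ ^ α := Real.rpow_pos_of_pos (norm_pos_iff.2 (sub_ne_zero.2 h)) _
  rw [← div_le_iff₀ hpos]
  refine le_csInf hf fun C hC => ?_
  rw [div_le_iff₀ hpos]
  exact hC.2 ζ τ hζ hτ

/-- Polynomials are dense in the disk algebra. -/
theorem exists_polynomial_norm_sub_lt {f : ℂ → ℂ} (hd : DifferentiableOn ℂ f (Metric.ball 0 1))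
    (hc : ContinuousOn f (Metric.closedBall 0 1)) {ε : ℝ} (hε : 0 < ε) :
    ∃ q : Polynomial ℂ, ∀ z : ℂ, ‖z‖ ≤ 1 → ‖f z - q.eval z‖ < ε := by
  obtain ⟨δ, hδ, hδf⟩ := Metric.uniformContinuousOn_iff.1
    ((isCompact_closedBall (0 : ℂ) 1).uniformContinuousOn_of_continuous hc) (ε / 2) (half_pos hε)
  obtain ⟨ρ, hρ1, hρ2⟩ := exists_between (max_lt (zero_lt_one (α := ℝ)) (sub_lt_self 1 hδ))
  have hρ0 : 0 < ρ := (le_max_left _ _).trans_lt hρ1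
  have hρδ : 1 - ρ < δ := by linarith [(le_max_right 0 (1 - δ)).trans_lt hρ1]
  obtain ⟨s, hs1, hs2⟩ := exists_between hρ2
  obtain ⟨R, hR1, hR2⟩ := exists_between hs2
  lift s to NNReal using (hρ0.trans hs1).le
  lift R to NNReal using (hρ0.trans (hs1.trans hR1)).le
  have hps := (hd.mono (Metric.closedBall_subset_ball hR2)).hasFPowerSeriesOnBall
    (by exact_mod_cast (hρ0.trans (hs1.trans hR1)))
  have hu := hps.tendstoUniformlyOn (r' := s) (by exact_mod_cast hR1)
  obtain ⟨n, hn⟩ := ((Metric.tendstoUniformlyOn_iff.1 hu (ε / 2) (half_pos hε))).exists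
  refine ⟨∑ k ∈ Finset.range n, Polynomial.C ((cauchyPowerSeries f 0 R).coeff k * (ρ : ℂ) ^ k) *
    Polynomial.X ^ k, fun z hz => ?_⟩
  have hρz : ‖(ρ : ℂ) * z‖ ≤ ρ := by
    rw [norm_mul, Complex.norm_real, Real.norm_of_nonneg hρ0.le]
    exact mul_le_of_le_one_right hρ0.le hz
  have h1 : dist (f z) (f (ρ * z)) < ε / 2 := by
    refine hδf z (by simpa using hz) _ (by simpa using hρz.trans hρ2.le) ?_
    rw [dist_eq_norm, show z - ρ * z = ((1 - ρ : ℝ) : ℂ) * z by push_cast; ring, norm_mul,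
      Complex.norm_real, Real.norm_of_nonneg (by linarith)]
    exact (mul_le_of_le_one_right (by linarith) hz).trans_lt hρδ
  have h2 := hn (ρ * z) (by simpa using hρz.trans_lt hs1)
  rw [zero_add] at h2
  have h3 : (cauchyPowerSeries f 0 R).partialSum n (ρ * z) =
      (∑ k ∈ Finset.range n, Polynomial.C ((cauchyPowerSeries f 0 R).coeff k * (ρ : ℂ) ^ k) *
        Polynomial.X ^ k).eval z := by
    rw [FormalMultilinearSeries.partialSum, Polynomial.eval_finsetSum]
    refine Finset.sum_congr rfl fun k _ => ?_
    rw [FormalMultilinearSeries.apply_eq_pow_smul_coeff]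
    simp
    ring
  rw [← h3, ← dist_eq_norm]
  linarith [dist_triangle (f z) (f (ρ * z)) ((cauchyPowerSeries f 0 R).partialSum n (ρ * z))]

end DiskAlgebra

section Approximation

theorem aeval_sub_comp_C_mul_X {H : Type} [NormedAddCommGroup H]
    [InnerProductSpace ℂ H] (q : Polynomial ℂ) (ρ : ℂ) (S : H →L[ℂ] H) :
    Polynomial.aeval S (q - q.comp (Polynomial.C ρ * Polynomial.X)) =
      Polynomial.aeval S q - Polynomial.aeval (ρ • S) q := by
  rw [map_sub, Polynomial.aeval_comp]
  simp [Algebra.algebraMap_eq_smul_one]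

theorem sum_norm_inner_add_le {H : Type} [NormedAddCommGroup H]
    [InnerProductSpace ℂ H] {k : ℕ} (e f : Fin k → H) (A B : H →L[ℂ] H) :
    ∑ j, ‖inner ℂ (f j) ((A + B) (e j))‖ ≤
      ∑ j, ‖inner ℂ (f j) (A (e j))‖ + ∑ j, ‖inner ℂ (f j) (B (e j))‖ := by
  rw [← Finset.sum_add_distrib]
  refine Finset.sum_le_sum fun j _ => ?_
  rw [_root_.add_apply, inner_add_right]
  exact norm_add_le _ _

theorem sum_norm_inner_le_norm {H : Type} [NormedAddCommGroup H]
    [InnerProductSpace ℂ H] {k : ℕ} {e f : Fin k → H} (he : Orthonormal ℂ e)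
    (hf : Orthonormal ℂ f) (A : H →L[ℂ] H) : ∑ j, ‖inner ℂ (f j) (A (e j))‖ ≤ k * ‖A‖ := by
  refine (Finset.sum_le_card_nsmul _ _ ‖A‖ fun j _ => ?_).trans_eq (by simp)
  refine (norm_inner_le_norm _ _).trans ?_
  rw [hf.1, one_mul]
  simpa [he.1] using A.le_opNorm (e j)

variable {H : Type} [NormedAddCommGroup H] [InnerProductSpace ℂ H] [CompleteSpace H]

theorem dyadicSum_nonneg (A : H →L[ℂ] H) (m : ℕ) : 0 ≤ dyadicSum A m :=
  add_nonneg (sVal_nonneg _ _) (Finset.sum_nonneg fun i _ =>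
    mul_nonneg (by positivity) (sVal_nonneg _ _))

theorem norm_eval_sub_comp_le {C α ε : ℝ} {f : ℂ → ℂ} (hα : 0 < α)
    (hC : 0 ≤ C)
    (hf : ∀ z τ : ℂ, ‖z‖ ≤ 1 → ‖τ‖ = 1 → ‖f z - f τ‖ ≤ C * ‖z - τ‖ ^ α) {q : Polynomial ℂ}
    (hq : ∀ z : ℂ, ‖z‖ ≤ 1 → ‖f z - q.eval z‖ ≤ ε) {ρ t : ℝ} (hρ0 : 0 ≤ ρ) (hρ1 : ρ ≤ 1)
    (hρt : 1 - ρ ≤ t) {z : ℂ} (hz : ‖z‖ = 1) :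
    ‖(q - q.comp (Polynomial.C (ρ : ℂ) * Polynomial.X)).eval z‖ ≤ C * t ^ α + 2 * ε := by
  have hρz : ‖(ρ : ℂ) * z‖ ≤ 1 := by
    rw [norm_mul, Complex.norm_real, Real.norm_of_nonneg hρ0, hz, mul_one]
    exact hρ1
  have h1 : ‖(ρ : ℂ) * z - z‖ = 1 - ρ := by
    rw [show (ρ : ℂ) * z - z = -(((1 - ρ : ℝ) : ℂ) * z) by push_cast; ring, norm_neg, norm_mul,
      Complex.norm_real, Real.norm_of_nonneg (by linarith), hz, mul_one]
  have h2 := hf (ρ * z) z hρz hz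
  rw [h1] at h2
  have h3 : (1 - ρ) ^ α ≤ t ^ α := Real.rpow_le_rpow (by linarith) hρt hα.le
  have h4 := hq z hz.le
  have h5 := hq _ hρz
  have h6 : (q - q.comp (Polynomial.C (ρ : ℂ) * Polynomial.X)).eval z =
      (f (ρ * z) - q.eval (ρ * z)) - (f z - q.eval z) - (f (ρ * z) - f z) := by
    simp only [Polynomial.eval_sub, Polynomial.eval_comp, Polynomial.eval_mul, Polynomial.eval_C,
      Polynomial.eval_X]
    ring
  rw [h6]
  have h7 := norm_sub_le ((f (ρ * z) - q.eval (ρ * z)) - (f z - q.eval z)) (f (ρ * z) - f z)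
  have h8 := norm_sub_le (f (ρ * z) - q.eval (ρ * z)) (f z - q.eval z)
  have h9 := mul_le_mul_of_nonneg_left h3 hC
  linarith

theorem sum_norm_inner_aeval_dilate_sub_le {T R : H →L[ℂ] H} (hT : ‖T‖ ≤ 1) (hR : ‖R‖ ≤ 1)
    {C α ε : ℝ} {h : ℂ → ℂ} (hα : 0 < α) (hC : 0 ≤ C)
    (hh : ∀ z τ : ℂ, ‖z‖ ≤ 1 → ‖τ‖ = 1 → ‖h z - h τ‖ ≤ C * ‖z - τ‖ ^ α) {q : Polynomial ℂ}
    (hq : ∀ z : ℂ, ‖z‖ ≤ 1 → ‖h z - q.eval z‖ ≤ ε) (m : ℕ) {e f : Fin (2 ^ m) → H}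
    (he : Orthonormal ℂ e) (hf : Orthonormal ℂ f) (N : ℕ) :
    ∑ j, ‖inner ℂ (f j) ((Polynomial.aeval (((1 - (1 / 2) ^ N : ℝ) : ℂ) • T) q -
        Polynomial.aeval (((1 - (1 / 2) ^ N : ℝ) : ℂ) • R) q) (e j))‖ ≤
      ∑ n ∈ Finset.range N, (C * ((1 / 2 : ℝ) ^ n) ^ α + 2 * ε) *
        (2 ^ (n + 1) * (6 * dyadicSum (T - R) m)) := by
  induction N with
  | zero => simp
  | succ n ih =>
    have hε : 0 ≤ ε := (norm_nonneg _).trans (hq 0 (by simp))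
    set x : ℝ := (1 / 2) ^ n with hx
    have hx0 : 0 < x := by positivity
    have hx1 : x ≤ 1 := pow_le_one₀ (by norm_num) (by norm_num)
    have hxs : (1 / 2 : ℝ) ^ (n + 1) = x / 2 := by rw [pow_succ]; ring
    have h2n : (2 : ℝ) ^ (n + 1) = (x / 2)⁻¹ := by rw [← hxs, one_div, inv_pow, inv_inv]
    rw [hxs, Finset.sum_range_succ]
    set ρ : ℝ := (1 - x) / (1 - x / 2) with hρ
    have hr0 : 0 < 1 - x / 2 := by linarith
    have hρr : ρ * (1 - x / 2) = 1 - x := div_mul_cancel₀ _ hr0.ne'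
    have hρ0 : 0 ≤ ρ := div_nonneg (by linarith) hr0.le
    have hρ1 : ρ ≤ 1 := (div_le_one hr0).2 (by linarith)
    have hρt : 1 - ρ ≤ x := by
      have : 1 - x ≤ ρ := by
        rw [hρ, le_div_iff₀ hr0]
        nlinarith
      linarith
    have hdil : ∀ T : H →L[ℂ] H, Polynomial.aeval (((1 - x / 2 : ℝ) : ℂ) • T) q =
        Polynomial.aeval (((1 - x : ℝ) : ℂ) • T) q + Polynomial.aeval (((1 - x / 2 : ℝ) : ℂ) • T)
          (q - q.comp (Polynomial.C (ρ : ℂ) * Polynomial.X)) := fun T => by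
      rw [aeval_sub_comp_C_mul_X, smul_smul, ← Complex.ofReal_mul, hρr, add_sub_cancel]
    rw [hdil T, hdil R, add_sub_add_comm]
    refine (sum_norm_inner_add_le e f _ _).trans (add_le_add ih ?_)
    refine (sum_norm_inner_aeval_sub_le hT hR hr0.le (by linarith) _
      (fun z hz => norm_eval_sub_comp_le hα hC hh hq hρ0 hρ1 hρt hz) m he hf).trans ?_
    have hW := dyadicSum_nonneg (T - R) m
    rw [h2n]
    gcongr
    nlinarith

theorem norm_aeval_sub_aeval_dilate_le {T : H →L[ℂ] H} (hT : ‖T‖ ≤ 1) {C α ε : ℝ} {h : ℂ → ℂ}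
    (hα : 0 < α) (hC : 0 ≤ C) (hε : 0 < ε)
    (hh : ∀ z τ : ℂ, ‖z‖ ≤ 1 → ‖τ‖ = 1 → ‖h z - h τ‖ ≤ C * ‖z - τ‖ ^ α) {q : Polynomial ℂ}
    (hq : ∀ z : ℂ, ‖z‖ ≤ 1 → ‖h z - q.eval z‖ ≤ ε) {t : ℝ} (ht0 : 0 ≤ t) (ht1 : t ≤ 1) :
    ‖Polynomial.aeval T q - Polynomial.aeval (((1 - t : ℝ) : ℂ) • T) q‖ ≤ C * t ^ α + 2 * ε := by
  rw [← aeval_sub_comp_C_mul_X]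
  exact norm_aeval_le_of_norm_le_one hT _ (by positivity) fun z hz =>
    norm_eval_sub_comp_le hα hC hh hq (by linarith) (by linarith) (by linarith) hz

theorem sum_norm_inner_aeval_sub_aeval_le {T R : H →L[ℂ] H} (hT : ‖T‖ ≤ 1) (hR : ‖R‖ ≤ 1)
    {C α ε : ℝ} {h : ℂ → ℂ} (hα : 0 < α) (hC : 0 ≤ C) (hε : 0 < ε)
    (hh : ∀ z τ : ℂ, ‖z‖ ≤ 1 → ‖τ‖ = 1 → ‖h z - h τ‖ ≤ C * ‖z - τ‖ ^ α) {q : Polynomial ℂ}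
    (hq : ∀ z : ℂ, ‖z‖ ≤ 1 → ‖h z - q.eval z‖ ≤ ε) (m : ℕ) {e f : Fin (2 ^ m) → H}
    (he : Orthonormal ℂ e) (hf : Orthonormal ℂ f) (N : ℕ) :
    ∑ j, ‖inner ℂ (f j) ((Polynomial.aeval T q - Polynomial.aeval R q) (e j))‖ ≤
      ∑ n ∈ Finset.range N, (C * ((1 / 2 : ℝ) ^ n) ^ α + 2 * ε) *
        (2 ^ (n + 1) * (6 * dyadicSum (T - R) m)) +
      2 ^ m * (2 * (C * ((1 / 2 : ℝ) ^ N) ^ α + 2 * ε)) := by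
  set t : ℝ := (1 / 2) ^ N with ht
  have ht0 : 0 ≤ t := by positivity
  have ht1 : t ≤ 1 := pow_le_one₀ (by norm_num) (by norm_num)
  have h1 : Polynomial.aeval T q - Polynomial.aeval R q =
      (Polynomial.aeval (((1 - t : ℝ) : ℂ) • T) q - Polynomial.aeval (((1 - t : ℝ) : ℂ) • R) q) +
      ((Polynomial.aeval T q - Polynomial.aeval (((1 - t : ℝ) : ℂ) • T) q) -
        (Polynomial.aeval R q - Polynomial.aeval (((1 - t : ℝ) : ℂ) • R) q)) := by abel
  rw [h1]
  refine (sum_norm_inner_add_le e f _ _).trans (add_le_add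
    (sum_norm_inner_aeval_dilate_sub_le hT hR hα hC hh hq m he hf N)
    ((sum_norm_inner_le_norm he hf _).trans ?_))
  push_cast
  gcongr
  refine (norm_sub_le _ _).trans ?_
  have h2 := norm_aeval_sub_aeval_dilate_le hT hα hC hε hh hq ht0 ht1
  have h3 := norm_aeval_sub_aeval_dilate_le hR hα hC hε hh hq ht0 ht1
  push_cast at h2 h3
  linarith

theorem sum_norm_inner_calc_sub_le {T R X Y : H →L[ℂ] H} (hT : ‖T‖ ≤ 1) (hR : ‖R‖ ≤ 1)
    {C α : ℝ} {h : ℂ → ℂ} (hα : 0 < α) (hC : 0 ≤ C)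
    (hd : DifferentiableOn ℂ h (Metric.ball 0 1)) (hc : ContinuousOn h (Metric.closedBall 0 1))
    (hh : HoelderCircleWith C α h) (hX : IsSzNagyCalc h T X) (hY : IsSzNagyCalc h R Y)
    (m : ℕ) {e f : Fin (2 ^ m) → H} (he : Orthonormal ℂ e) (hf : Orthonormal ℂ f) (N : ℕ) :
    ∑ j, ‖inner ℂ (f j) ((X - Y) (e j))‖ ≤
      ∑ n ∈ Finset.range N, (C * ((1 / 2 : ℝ) ^ n) ^ α) *
        (2 ^ (n + 1) * (6 * dyadicSum (T - R) m)) +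
      2 ^ m * (2 * (C * ((1 / 2 : ℝ) ^ N) ^ α)) := by
  have hlim : Tendsto (fun k : ℕ => 1 / ((k : ℝ) + 1)) atTop (𝓝 0) :=
    tendsto_one_div_add_atTop_nhds_zero_nat
  have hpos : ∀ k : ℕ, 0 < 1 / ((k : ℝ) + 1) := fun k => by positivity
  choose q hq using fun k => exists_polynomial_norm_sub_lt hd hc (hpos k)
  have hu : TendstoUniformlyOn (fun k z => (q k).eval z) h atTop (Metric.closedBall 0 1) := by
    rw [Metric.tendstoUniformlyOn_iff]
    intro ε hε
    filter_upwards [hlim.eventually (gt_mem_nhds hε)] with k hk z hz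
    rw [dist_eq_norm]
    exact (hq k z (by simpa using hz)).trans hk
  have hXY := (hX q hu).sub (hY q hu)
  have hleft : Tendsto (fun k => ∑ j, ‖inner ℂ (f j)
      ((Polynomial.aeval T (q k) - Polynomial.aeval R (q k)) (e j))‖) atTop
      (𝓝 (∑ j, ‖inner ℂ (f j) ((X - Y) (e j))‖)) := by
    have hcont : Continuous fun A : H →L[ℂ] H => ∑ j, ‖inner ℂ (f j) (A (e j))‖ := by fun_prop
    exact (hcont.tendsto _).comp hXY
  have hcont : Continuous fun ε : ℝ => ∑ n ∈ Finset.range N,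
      (C * ((1 / 2 : ℝ) ^ n) ^ α + 2 * ε) * (2 ^ (n + 1) * (6 * dyadicSum (T - R) m)) +
      2 ^ m * (2 * (C * ((1 / 2 : ℝ) ^ N) ^ α + 2 * ε)) := by fun_prop
  have hright := (hcont.tendsto 0).comp hlim
  simp only [mul_zero, add_zero] at hright
  exact le_of_tendsto_of_tendsto' hleft hright fun k =>
    sum_norm_inner_aeval_sub_aeval_le hT hR hα hC (hpos k)
      (fun z τ hz hτ => hh.norm_sub_le hα hd hc hz hτ) (fun z hz => (hq k z hz).le) m he hf N

theorem exists_half_pow_le_and_mul_two_pow_le {τ : ℝ} (hτ : 0 < τ) :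
    ∃ N : ℕ, (1 / 2 : ℝ) ^ N ≤ τ ∧ (N = 0 ∨ τ * 2 ^ N ≤ 2) := by
  rcases le_or_gt 1 τ with h | h
  · exact ⟨0, by simpa using h, Or.inl rfl⟩
  · obtain ⟨n, hn1, hn2⟩ := exists_nat_pow_near_of_lt_one hτ h.le (y := (1 / 2 : ℝ))
      (by norm_num) (by norm_num)
    refine ⟨n + 1, hn1.le, Or.inr ?_⟩
    have h2 : (1 / 2 : ℝ) ^ n * 2 ^ n = 1 := by rw [← mul_pow]; norm_num
    have h3 := mul_le_mul_of_nonneg_right hn2 (by positivity : (0 : ℝ) ≤ 2 ^ n)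
    rw [pow_succ]
    linarith

theorem half_pow_rpow_mul_two_pow (α : ℝ) (n : ℕ) :
    ((1 / 2 : ℝ) ^ n) ^ α * 2 ^ n = ((2 : ℝ) ^ (1 - α)) ^ n := by
  rw [one_div, inv_pow, Real.inv_rpow (by positivity), ← Real.rpow_natCast 2 n, ← Real.rpow_mul
    (by norm_num), ← Real.rpow_neg (by norm_num), ← Real.rpow_add (by norm_num),
    ← Real.rpow_natCast (2 ^ (1 - α)) n, ← Real.rpow_mul (by norm_num)]
  congr 1
  ring

theorem one_lt_two_rpow_one_sub {α : ℝ} (hα1 : α < 1) : (1 : ℝ) < 2 ^ (1 - α) :=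
  Real.one_lt_rpow (by norm_num) (by linarith)

theorem sum_half_pow_rpow_mul_le {α τ w : ℝ} (hα0 : 0 < α) (hα1 : α < 1) (hτ : 0 < τ)
    (hw : 0 ≤ w) (hwτ : w ≤ τ) :
    ∃ N : ℕ, ∑ n ∈ Finset.range N, ((1 / 2 : ℝ) ^ n) ^ α * (2 ^ (n + 1) * (6 * w)) +
      2 * ((1 / 2 : ℝ) ^ N) ^ α ≤ (24 / (2 ^ (1 - α) - 1) + 2) * τ ^ α := by
  obtain ⟨N, hN1, hN2⟩ := exists_half_pow_le_and_mul_two_pow_le hτ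
  refine ⟨N, ?_⟩
  have hb : (0 : ℝ) < 2 ^ (1 - α) - 1 := sub_pos.2 (one_lt_two_rpow_one_sub hα1)
  have hpow : ((1 / 2 : ℝ) ^ N) ^ α ≤ τ ^ α := Real.rpow_le_rpow (by positivity) hN1 hα0.le
  have hτα : 0 ≤ τ ^ α := Real.rpow_nonneg hτ.le _
  rw [add_mul]
  refine add_le_add ?_ (by gcongr)
  rcases hN2 with rfl | hN2
  · simp only [Finset.range_zero, Finset.sum_empty]
    positivity
  have hsum : ∑ n ∈ Finset.range N, ((1 / 2 : ℝ) ^ n) ^ α * (2 ^ (n + 1) * (6 * w)) =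
      12 * w * ((((2 : ℝ) ^ (1 - α)) ^ N - 1) / (2 ^ (1 - α) - 1)) := by
    rw [← geom_sum_eq (one_lt_two_rpow_one_sub hα1).ne', Finset.mul_sum]
    refine Finset.sum_congr rfl fun n _ => ?_
    rw [← half_pow_rpow_mul_two_pow, pow_succ]
    ring
  rw [hsum, div_mul_eq_mul_div, mul_div_assoc']
  refine div_le_div_of_nonneg_right ?_ hb.le
  have h1 : w * ((2 : ℝ) ^ (1 - α)) ^ N ≤ 2 * τ ^ α := by
    rw [← half_pow_rpow_mul_two_pow]
    calc w * (((1 / 2 : ℝ) ^ N) ^ α * 2 ^ N) ≤ τ * (τ ^ α * 2 ^ N) := by gcongr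
      _ = (τ * 2 ^ N) * τ ^ α := by ring
      _ ≤ 2 * τ ^ α := by gcongr
  nlinarith

/-- The main singular value estimate. -/
theorem sVal_calc_sub_le {T R X Y : H →L[ℂ] H} (hT : ‖T‖ ≤ 1) (hR : ‖R‖ ≤ 1)
    {C α : ℝ} {h : ℂ → ℂ} (hα0 : 0 < α) (hα1 : α < 1) (hC : 0 ≤ C)
    (hd : DifferentiableOn ℂ h (Metric.ball 0 1)) (hc : ContinuousOn h (Metric.closedBall 0 1))
    (hh : HoelderCircleWith C α h) (hX : IsSzNagyCalc h T X) (hY : IsSzNagyCalc h R Y) (m : ℕ) :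
    sVal (X - Y) (2 * (2 ^ m - 1)) ≤
      (24 / (2 ^ (1 - α) - 1) + 2) * C * (dyadicSum (T - R) m / 2 ^ m) ^ α := by
  set w := dyadicSum (T - R) m / 2 ^ m with hw
  have hw0 : 0 ≤ w := div_nonneg (dyadicSum_nonneg _ _) (by positivity)
  have hb : (0 : ℝ) < 2 ^ (1 - α) - 1 := sub_pos.2 (one_lt_two_rpow_one_sub hα1)
  have hW : dyadicSum (T - R) m = 2 ^ m * w := by rw [hw]; field_simp
  have key : ∀ τ : ℝ, w < τ →
      sVal (X - Y) (2 * (2 ^ m - 1)) ≤ (24 / (2 ^ (1 - α) - 1) + 2) * C * τ ^ α := by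
    intro τ hτ
    have hτ0 : 0 < τ := hw0.trans_lt hτ
    have hτα : 0 ≤ τ ^ α := Real.rpow_nonneg hτ0.le _
    obtain ⟨N, hN⟩ := sum_half_pow_rpow_mul_le hα0 hα1 hτ0 hw0 hτ.le
    refine sVal_le_of_sum_inner_le _ (by positivity) (by positivity) fun e f he hf => ?_
    refine (sum_norm_inner_calc_sub_le hT hR hα0 hC hd hc hh hX hY m he hf N).trans ?_
    have h1 := mul_le_mul_of_nonneg_left hN (mul_nonneg (by positivity : (0 : ℝ) ≤ 2 ^ m) hC)
    rw [mul_add, Finset.mul_sum] at h1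
    push_cast
    refine le_trans (le_of_eq ?_) (h1.trans_eq (by ring))
    rw [hW]
    congr 1
    · exact Finset.sum_congr rfl fun n _ => by ring
    · ring
  have hcont : Continuous fun τ : ℝ => (24 / (2 ^ (1 - α) - 1) + 2) * C * τ ^ α :=
    continuous_const.mul (Real.continuous_rpow_const hα0.le)
  exact ge_of_tendsto ((hcont.tendsto w).mono_left (nhdsWithin_le_nhds (s := Set.Ioi w)))
    (by filter_upwards [self_mem_nhdsWithin] with τ hτ using key τ hτ)

end Approximation

section Summation

/-- The dyadic average of a sequence. -/
def dyadicMean (s : ℕ → ℝ) (m : ℕ) : ℝ :=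
  (s 0 + ∑ i ∈ Finset.range (m + 1), 2 ^ i * s (2 ^ i)) / 2 ^ m

theorem dyadicMean_nonneg {s : ℕ → ℝ} (hs : ∀ j, 0 ≤ s j) (m : ℕ) : 0 ≤ dyadicMean s m :=
  div_nonneg (add_nonneg (hs 0) (Finset.sum_nonneg fun i _ => mul_nonneg (by positivity) (hs _)))
    (by positivity)

theorem dyadicMean_succ (s : ℕ → ℝ) (m : ℕ) :
    dyadicMean s (m + 1) = dyadicMean s m / 2 + s (2 ^ (m + 1)) := by
  rw [dyadicMean, dyadicMean, Finset.sum_range_succ _ (m + 1)]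
  field_simp
  ring

theorem rpow_add_le_of_one_lt {p x y : ℝ} (hp : 1 < p) (hx : 0 ≤ x) (hy : 0 ≤ y) :
    (x + y) ^ p ≤ (3 / 4 : ℝ) ^ (1 - p) * x ^ p + (1 / 4 : ℝ) ^ (1 - p) * y ^ p := by
  have h := (convexOn_rpow hp.le).2
    (Set.mem_Ici.2 (by positivity : 0 ≤ x / (3 / 4)))
    (Set.mem_Ici.2 (by positivity : 0 ≤ y / (1 / 4)))
    (by norm_num : (0 : ℝ) ≤ 3 / 4) (by norm_num : (0 : ℝ) ≤ 1 / 4) (by norm_num)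
  simp only [smul_eq_mul] at h
  have hscale : ∀ t x : ℝ, 0 < t → 0 ≤ x → t * (x / t) ^ p = t ^ (1 - p) * x ^ p := by
    intro t x ht hx
    rw [Real.div_rpow hx ht.le, Real.rpow_sub ht, Real.rpow_one]
    ring
  rw [hscale _ _ (by norm_num) hx, hscale _ _ (by norm_num) hy] at h
  rwa [mul_div_cancel₀ _ (by norm_num), mul_div_cancel₀ _ (by norm_num)] at h

theorem two_pow_mul_dyadicMean_succ_rpow_le {s : ℕ → ℝ} (hs : ∀ j, 0 ≤ s j) {p : ℝ} (hp : 1 < p)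
    (m : ℕ) :
    2 ^ (m + 1) * dyadicMean s (m + 1) ^ p ≤
      (3 / 2 : ℝ) ^ (1 - p) * (2 ^ m * dyadicMean s m ^ p) +
        (1 / 4 : ℝ) ^ (1 - p) * (2 ^ (m + 1) * s (2 ^ (m + 1)) ^ p) := by
  have hw := dyadicMean_nonneg hs m
  rw [dyadicMean_succ]
  refine (mul_le_mul_of_nonneg_left
    (rpow_add_le_of_one_lt hp (by positivity) (hs _)) (by positivity)).trans_eq ?_
  have h : (3 / 2 : ℝ) ^ (1 - p) = (3 / 4 : ℝ) ^ (1 - p) * (2 / 2 ^ p) := by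
    rw [show (3 / 2 : ℝ) = 3 / 4 * 2 by norm_num, Real.mul_rpow (by norm_num) (by norm_num),
      Real.rpow_sub two_pos, Real.rpow_one]
  rw [h, Real.div_rpow hw two_pos.le, pow_succ]
  ring

/-- The constant of the dyadic Hardy inequality. -/
def dyadicHardyConst (p : ℝ) : ℝ :=
  (2 ^ p + (1 / 4 : ℝ) ^ (1 - p) * 3) / (1 - (3 / 2 : ℝ) ^ (1 - p))

theorem three_halves_rpow_lt_one {p : ℝ} (hp : 1 < p) : (3 / 2 : ℝ) ^ (1 - p) < 1 :=
  Real.rpow_lt_one_of_one_lt_of_neg (by norm_num) (by linarith)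

theorem dyadicHardyConst_pos {p : ℝ} (hp : 1 < p) : 0 < dyadicHardyConst p :=
  div_pos (by positivity) (sub_pos.2 (three_halves_rpow_lt_one hp))

theorem sum_two_pow_mul_succ_le_tsum {u : ℕ → ℝ} (hu0 : ∀ j, 0 ≤ u j) (hu : Antitone u)
    (hsum : Summable u) (M : ℕ) :
    ∑ m ∈ Finset.range M, 2 ^ (m + 1) * u (2 ^ (m + 1)) ≤ 3 * ∑' j, u j := by
  have h := Finset.sum_condensed_le (fun m n _ hmn => hu hmn) M (f := u)
  rw [Finset.sum_range_succ'] at h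
  simp only [nsmul_eq_mul, Nat.cast_pow, Nat.cast_ofNat, pow_zero, Nat.cast_one, one_mul] at h
  have h1 := hsum.sum_le_tsum (Finset.Ico 2 (2 ^ M + 1)) fun j _ => hu0 j
  have h2 : 0 ≤ ∑' j, u j := tsum_nonneg hu0
  linarith

/-- A dyadic version of Hardy's inequality. -/
theorem sum_two_pow_mul_dyadicMean_rpow_le {s : ℕ → ℝ} (hs0 : ∀ j, 0 ≤ s j) (hs : Antitone s)
    {p : ℝ} (hp : 1 < p) (hsum : Summable fun j => s j ^ p) (M : ℕ) :
    ∑ m ∈ Finset.range M, 2 ^ m * dyadicMean s m ^ p ≤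
      dyadicHardyConst p * ∑' j, s j ^ p := by
  have hp0 : 0 ≤ p := by linarith
  have hu0 : ∀ j, 0 ≤ s j ^ p := fun j => Real.rpow_nonneg (hs0 j) _
  have hu : Antitone fun j => s j ^ p := fun i j hij => Real.rpow_le_rpow (hs0 j) (hs hij) hp0
  have hθ := three_halves_rpow_lt_one hp
  have hterm : ∀ m, 0 ≤ 2 ^ m * dyadicMean s m ^ p := fun m =>
    mul_nonneg (by positivity) (Real.rpow_nonneg (dyadicMean_nonneg hs0 m) _)
  have hzero : dyadicMean s 0 ^ p ≤ 2 ^ p * ∑' j, s j ^ p := by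
    have h1 : dyadicMean s 0 ≤ 2 * s 0 := by
      have := hs (zero_le_one (α := ℕ))
      simp only [dyadicMean, zero_add, Finset.range_one, Finset.sum_singleton, pow_zero, one_mul,
        div_one]
      linarith
    calc dyadicMean s 0 ^ p ≤ (2 * s 0) ^ p :=
          Real.rpow_le_rpow (dyadicMean_nonneg hs0 0) h1 hp0
      _ = 2 ^ p * s 0 ^ p := Real.mul_rpow two_pos.le (hs0 0)
      _ ≤ _ := by
          gcongr
          exact hsum.le_tsum 0 fun j _ => hu0 j
  have hA := sum_two_pow_mul_succ_le_tsum hu0 hu hsum M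
  have hrec : ∑ m ∈ Finset.range (M + 1), 2 ^ m * dyadicMean s m ^ p ≤
      (3 / 2 : ℝ) ^ (1 - p) * ∑ m ∈ Finset.range M, 2 ^ m * dyadicMean s m ^ p +
        (1 / 4 : ℝ) ^ (1 - p) * ∑ m ∈ Finset.range M, 2 ^ (m + 1) * s (2 ^ (m + 1)) ^ p +
        dyadicMean s 0 ^ p := by
    rw [Finset.sum_range_succ', Finset.mul_sum, Finset.mul_sum, ← Finset.sum_add_distrib,
      pow_zero, one_mul]
    gcongr with m
    exact two_pow_mul_dyadicMean_succ_rpow_le hs0 hp m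
  rw [Finset.sum_range_succ] at hrec
  have hκ : 0 ≤ (1 / 4 : ℝ) ^ (1 - p) := by positivity
  have h3 := mul_le_mul_of_nonneg_left hA hκ
  rw [dyadicHardyConst, div_mul_eq_mul_div, le_div_iff₀ (sub_pos.2 hθ)]
  nlinarith [hterm M]

theorem sum_range_le_sum_dyadic_blocks {v : ℕ → ℝ} (hv : Antitone v) (M : ℕ) :
    ∑ j ∈ Finset.range (2 * (2 ^ M - 1)), v j ≤
      ∑ m ∈ Finset.range M, 2 ^ (m + 1) * v (2 * (2 ^ m - 1)) := by
  induction M with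
  | zero => simp
  | succ M ih =>
    have h : 2 * (2 ^ (M + 1) - 1) = 2 * (2 ^ M - 1) + 2 ^ (M + 1) := by
      have := Nat.one_le_two_pow (n := M)
      rw [pow_succ]
      omega
    rw [h, Finset.sum_range_add, Finset.sum_range_succ _ M]
    refine add_le_add ih ((Finset.sum_le_card_nsmul _ _ (v (2 * (2 ^ M - 1))) fun j _ =>
      hv (Nat.le_add_right _ _)).trans_eq ?_)
    simp

theorem sum_rpow_le_of_le_dyadicMean {s v : ℕ → ℝ} (hs0 : ∀ j, 0 ≤ s j) (hs : Antitone s)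
    (hv0 : ∀ j, 0 ≤ v j) (hv : Antitone v) {α p B : ℝ} (hα : 0 < α) (hp : 1 < p) (hB : 0 ≤ B)
    (hsum : Summable fun j => s j ^ p)
    (h : ∀ m, v (2 * (2 ^ m - 1)) ≤ B * dyadicMean s m ^ α) (n : ℕ) :
    ∑ j ∈ Finset.range n, v j ^ (p / α) ≤
      B ^ (p / α) * (2 * dyadicHardyConst p * ∑' j, s j ^ p) := by
  have hr : 0 ≤ p / α := div_nonneg (by linarith) hα.le
  have hvr : Antitone fun j => v j ^ (p / α) := fun i j hij =>
    Real.rpow_le_rpow (hv0 j) (hv hij) hr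
  have hn : n ≤ 2 * (2 ^ n - 1) := by
    have := Nat.lt_two_pow_self (n := n)
    omega
  calc ∑ j ∈ Finset.range n, v j ^ (p / α)
      ≤ ∑ j ∈ Finset.range (2 * (2 ^ n - 1)), v j ^ (p / α) :=
        Finset.sum_le_sum_of_subset_of_nonneg (Finset.range_mono hn) fun j _ _ =>
          Real.rpow_nonneg (hv0 j) _
    _ ≤ ∑ m ∈ Finset.range n, 2 ^ (m + 1) * v (2 * (2 ^ m - 1)) ^ (p / α) :=
        sum_range_le_sum_dyadic_blocks hvr n
    _ ≤ ∑ m ∈ Finset.range n, B ^ (p / α) * 2 * (2 ^ m * dyadicMean s m ^ p) := by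
        refine Finset.sum_le_sum fun m _ => ?_
        have hw := dyadicMean_nonneg hs0 m
        have h1 := Real.rpow_le_rpow (hv0 _) (h m) hr
        rw [Real.mul_rpow hB (Real.rpow_nonneg hw _), ← Real.rpow_mul hw,
          mul_div_cancel₀ _ hα.ne'] at h1
        refine (mul_le_mul_of_nonneg_left h1 (by positivity)).trans_eq ?_
        rw [pow_succ]
        ring
    _ ≤ B ^ (p / α) * 2 * (dyadicHardyConst p * ∑' j, s j ^ p) := by
        rw [← Finset.mul_sum]
        exact mul_le_mul_of_nonneg_left (sum_two_pow_mul_dyadicMean_rpow_le hs0 hs hp hsum n)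
          (by positivity)
    _ = _ := by ring

end Summation

theorem stmt10 (α p : ℝ) (hα0 : 0 < α) (hα1 : α < 1) (hp : 1 < p) :
    ∃ c : ℝ, 0 < c ∧
      ∀ (H : Type) [NormedAddCommGroup H] [InnerProductSpace ℂ H] [CompleteSpace H]
        [TopologicalSpace.SeparableSpace H],
        ∀ f : ℂ → ℂ,
          DifferentiableOn ℂ f (Metric.ball (0 : ℂ) 1) →
          ContinuousOn f (Metric.closedBall (0 : ℂ) 1) →
          MemHoelderCircle α f →
        ∀ T R : H →L[ℂ] H, ‖T‖ ≤ 1 → ‖R‖ ≤ 1 →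
          MemSchatten p (T - R) →
        ∀ X Y : H →L[ℂ] H, IsSzNagyCalc f T X → IsSzNagyCalc f R Y →
            MemSchatten (p / α) (X - Y) ∧
            schNorm (p / α) (X - Y) ≤
              c * hoelderCircleNorm α f * schNorm p (T - R) ^ α := by
  have hb : (0 : ℝ) < 2 ^ (1 - α) - 1 := sub_pos.2 (one_lt_two_rpow_one_sub hα1)
  have hK := dyadicHardyConst_pos hp
  have hp0 : 0 < p := by linarith
  have hr : 0 < p / α := div_pos hp0 hα0
  refine ⟨(24 / (2 ^ (1 - α) - 1) + 2) * (2 * dyadicHardyConst p) ^ (1 / (p / α)),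
    by positivity, ?_⟩
  intro H _ _ _ _ f hd hc hf T R hT hR hTR X Y hX hY
  set C := hoelderCircleNorm α f
  have hC : 0 ≤ C := hoelderCircleNorm_nonneg α f
  have hB : 0 ≤ (24 / (2 ^ (1 - α) - 1) + 2) * C := by positivity
  have hbound := sum_rpow_le_of_le_dyadicMean (sVal_nonneg (T - R)) (sVal_antitone (T - R))
    (sVal_nonneg (X - Y)) (sVal_antitone (X - Y)) hα0 hp hB hTR
    (sVal_calc_sub_le hT hR hα0 hα1 hC hd hc (hf.hoelderCircleWith hα0) hX hY)
  have hnonneg : ∀ j, 0 ≤ sVal (X - Y) j ^ (p / α) := fun j => Real.rpow_nonneg (sVal_nonneg _ _) _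
  refine ⟨summable_of_sum_range_le hnonneg hbound, ?_⟩
  have htr : 0 ≤ ∑' j, sVal (T - R) j ^ p :=
    tsum_nonneg fun j => Real.rpow_nonneg (sVal_nonneg _ _) _
  calc schNorm (p / α) (X - Y)
      ≤ (((24 / (2 ^ (1 - α) - 1) + 2) * C) ^ (p / α) *
          (2 * dyadicHardyConst p * ∑' j, sVal (T - R) j ^ p)) ^ (1 / (p / α)) :=
        Real.rpow_le_rpow (tsum_nonneg hnonneg) (Real.tsum_le_of_sum_range_le hnonneg hbound)
          (by positivity)
    _ = (24 / (2 ^ (1 - α) - 1) + 2) * C * ((2 * dyadicHardyConst p) ^ (1 / (p / α)) *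
          (∑' j, sVal (T - R) j ^ p) ^ (1 / (p / α))) := by
        rw [Real.mul_rpow (by positivity) (by positivity), ← Real.rpow_mul hB,
          mul_one_div_cancel hr.ne', Real.rpow_one, Real.mul_rpow (by positivity) htr]
    _ = _ := by
        rw [schNorm, ← Real.rpow_mul htr, show 1 / (p / α) = 1 / p * α by field_simp]
        ring
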